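/- arXiv:1906.11274 — 2 statements merged into one kernel-verified Lean document; each statement's English description precedes it below -/
import Mathlib

section
/- Let 1 < p < 5, f : ℝ → ℝ with |f(s)| ≤ C₀·s^((p-1)/2) for s ≥ 0, and V : ℝ → ℝ a nonzero even Schwartz function with ∫_ℝ (|V(x)| + |V'(x)|)·cosh(2x) dx < ∞. There exist μ₀ > 0, ε > 0 and C > 0 such that for every μ ∈ (0, μ₀): if u is a smooth solution of i∂ₜu + ∂ₓₓu = μV(x)u + f(|u|²)u, odd in x, with u(t,·) in the Schwartz class in x for each t and sup_{t∈ℝ}(‖u(t,·)‖_{L²(ℝ)}² + ‖∂ₓu(t,·)‖_{L²(ℝ)}²) ≤ ε², then ∫₀^∞ ∫_ℝ sech(x)(|∂ₓu(t,x)|² + |u(t,x)|²) dx dt ≤ C·ε². -/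
open MeasureTheory Real

namespace NLSaux

lemma int_le_sub {F F' g : ℝ → ℝ} (hF : ∀ x, HasDerivAt F (F' x) x) (hc : Continuous F')
    (hg : Continuous g) {R : ℝ} (hR : 0 ≤ R) (h : ∀ x ∈ Set.Icc 0 R, g x ≤ F' x) :
    ∫ x in (0:ℝ)..R, g x ≤ F R - F 0 := by
  rw [← intervalIntegral.integral_eq_sub_of_hasDerivAt (fun x _ => hF x)
    (hc.intervalIntegrable _ _)]
  exact intervalIntegral.integral_mono_on hR (hg.intervalIntegrable _ _)
    (hc.intervalIntegrable _ _) h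

/-- The virial identity at fixed time, in real and imaginary parts. -/
lemma virial_id {a b a1 b1 a2 b2 at' bt atx btx N G P P1 φ φ1 φ2 : ℝ → ℝ} {R : ℝ}
    (ha : ∀ x, HasDerivAt a (a1 x) x) (hb : ∀ x, HasDerivAt b (b1 x) x)
    (ha1 : ∀ x, HasDerivAt a1 (a2 x) x) (hb1 : ∀ x, HasDerivAt b1 (b2 x) x)
    (hat : ∀ x, HasDerivAt at' (atx x) x) (hbt : ∀ x, HasDerivAt bt (btx x) x)
    (hG : ∀ x, HasDerivAt G (N x * (2 * (a x * a1 x + b x * b1 x))) x)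
    (hP : ∀ x, HasDerivAt P (P1 x) x)
    (hφ : ∀ x, HasDerivAt φ (φ1 x) x) (hφ1 : ∀ x, HasDerivAt φ1 (φ2 x) x)
    (hatx : Continuous atx) (hbtx : Continuous btx) (hN : Continuous N) (hP1 : Continuous P1)
    (hφ2 : Continuous φ2)
    (e1 : ∀ x, - bt x + a2 x = (P x + N x) * a x)
    (e2 : ∀ x, at' x + b2 x = (P x + N x) * b x)
    (a0 : a 0 = 0) (b0 : b 0 = 0) (φ0 : φ 0 = 0) (φR : φ R = 0) (φ1R : φ1 R = 0) :
    ∫ x in (0:ℝ)..R, φ x * (at' x * b1 x + a x * btx x - bt x * a1 x - b x * atx x)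
      = ∫ x in (0:ℝ)..R, (2 * φ1 x * (a1 x ^ 2 + b1 x ^ 2) + φ2 x * (a x * a1 x + b x * b1 x)
        - φ x * P1 x * (a x ^ 2 + b x ^ 2) + φ1 x * (N x * (a x ^ 2 + b x ^ 2) - G x)) := by
  have cont : ∀ {f g : ℝ → ℝ}, (∀ x, HasDerivAt f (g x) x) → Continuous f := fun h =>
    continuous_iff_continuousAt.2 fun x => (h x).continuousAt
  have ca := cont ha
  have cb := cont hb
  have ca1 := cont ha1
  have cb1 := cont hb1
  have cat := cont hat
  have cbt := cont hbt
  have cG := cont hG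
  have cP := cont hP
  have cφ := cont hφ
  have cφ1 := cont hφ1
  rw [← sub_eq_zero, ← intervalIntegral.integral_sub
    (Continuous.intervalIntegrable (by fun_prop) _ _)
    (Continuous.intervalIntegrable (by fun_prop) _ _)]
  let W : ℝ → ℝ := fun x => φ x * (a x * bt x - b x * at' x) - φ x * (a1 x ^ 2 + b1 x ^ 2)
    + φ x * P x * (a x ^ 2 + b x ^ 2) + φ x * G x - φ1 x * (a x * a1 x + b x * b1 x)
  have key : ∀ x, HasDerivAt W
      ((φ x * (at' x * b1 x + a x * btx x - bt x * a1 x - b x * atx x)) -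
      (2 * φ1 x * (a1 x ^ 2 + b1 x ^ 2) + φ2 x * (a x * a1 x + b x * b1 x)
        - φ x * P1 x * (a x ^ 2 + b x ^ 2) + φ1 x * (N x * (a x ^ 2 + b x ^ 2) - G x))) x := by
    intro x
    have := (((((hφ x).mul (((ha x).mul (hbt x)).sub ((hb x).mul (hat x)))).sub
      ((hφ x).mul (((ha1 x).pow 2).add ((hb1 x).pow 2)))).add
      (((hφ x).mul (hP x)).mul (((ha x).pow 2).add ((hb x).pow 2)))).add
      ((hφ x).mul (hG x))).sub ((hφ1 x).mul (((ha x).mul (ha1 x)).add ((hb x).mul (hb1 x))))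
    refine this.congr_deriv ?_
    have h1 : bt x = a2 x - (P x + N x) * a x := by linarith [e1 x]
    have h2 : at' x = (P x + N x) * b x - b2 x := by linarith [e2 x]
    simp only [Pi.mul_apply, Pi.add_apply, Pi.sub_apply, Pi.pow_apply, h1, h2]
    push_cast
    ring
  rw [intervalIntegral.integral_eq_sub_of_hasDerivAt (fun x _ => key x)
    (Continuous.intervalIntegrable (by fun_prop) _ _)]
  simp [W, a0, b0, φ0, φR, φ1R]

section fixed
variable {a b a1 b1 : ℝ → ℝ} {R : ℝ}

lemma hder (ha : ∀ x, HasDerivAt a (a1 x) x) (hb : ∀ x, HasDerivAt b (b1 x) x) (x : ℝ) :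
    HasDerivAt (fun x => a x ^ 2 + b x ^ 2) (2 * (a x * a1 x + b x * b1 x)) x := by
  refine (((ha x).pow 2).add ((hb x).pow 2)).congr_deriv ?_
  push_cast; ring

lemma eder (c x : ℝ) : HasDerivAt (fun x : ℝ => exp (-(c * x))) (-c * exp (-(c * x))) x := by
  have := ((hasDerivAt_id x).const_mul c).neg.exp
  refine this.congr_deriv ?_
  simp; ring

lemma sup_bound (ha : ∀ x, HasDerivAt a (a1 x) x) (hb : ∀ x, HasDerivAt b (b1 x) x)
    (ca1 : Continuous a1) (cb1 : Continuous b1) (a0 : a 0 = 0) (b0 : b 0 = 0)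
    {x : ℝ} (hx : x ∈ Set.Icc 0 R) :
    exp (-(1/2 * x)) * (a x ^ 2 + b x ^ 2) ≤
      4 * ∫ y in (0:ℝ)..R, exp (-(1/4 * y)) * ((a1 y - a y / 8) ^ 2 + (b1 y - b y / 8) ^ 2) := by
  have ca : Continuous a := continuous_iff_continuousAt.2 fun x => (ha x).continuousAt
  have cb : Continuous b := continuous_iff_continuousAt.2 fun x => (hb x).continuousAt
  have h1 := int_le_sub (F := fun x => - (exp (-(1/2 * x)) * (a x ^ 2 + b x ^ 2)))
    (g := fun y => -(4 * (exp (-(1/4 * y)) * ((a1 y - a y / 8) ^ 2 + (b1 y - b y / 8) ^ 2))))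
    (fun x => ((eder (1/2) x).mul (hder ha hb x)).neg) (by fun_prop) (by fun_prop) hx.1 (by
      intro y hy
      have he : exp (-(1/2 * y)) ≤ exp (-(1/4 * y)) := by
        apply exp_le_exp.2; linarith [hy.1]
      have h0 := exp_pos (-(1/2 * y))
      have hz : 0 ≤ (a1 y - a y / 8) ^ 2 + (b1 y - b y / 8) ^ 2 := by positivity
      have := mul_le_mul_of_nonneg_right he hz
      have h3 : 0 ≤ exp (-(1/2 * y)) * ((a y / 2 - 2 * (a1 y - a y / 8)) ^ 2 +
        (b y / 2 - 2 * (b1 y - b y / 8)) ^ 2) := by positivity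
      nlinarith)
  simp only [a0, b0, intervalIntegral.integral_neg, intervalIntegral.integral_const_mul] at h1
  have h2 : ∫ y in (0:ℝ)..x, exp (-(1/4 * y)) * ((a1 y - a y / 8) ^ 2 + (b1 y - b y / 8) ^ 2) ≤
    ∫ y in (0:ℝ)..R, exp (-(1/4 * y)) * ((a1 y - a y / 8) ^ 2 + (b1 y - b y / 8) ^ 2) := by
    apply intervalIntegral.integral_mono_interval le_rfl hx.1 hx.2
    · exact Filter.Eventually.of_forall fun y => by positivity
    · exact Continuous.intervalIntegrable (by fun_prop) _ _
  norm_num at h1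
  norm_num at h2 ⊢
  linarith

lemma kmm (ha : ∀ x, HasDerivAt a (a1 x) x) (hb : ∀ x, HasDerivAt b (b1 x) x)
    (ca1 : Continuous a1) (cb1 : Continuous b1) (a0 : a 0 = 0) (b0 : b 0 = 0)
    (hR : 0 ≤ R) {q η : ℝ} (hq : 0 < q)
    (hη : ∀ x ∈ Set.Icc 0 R, (a x ^ 2 + b x ^ 2) ^ q ≤ η) :
    q / 8 * ∫ y in (0:ℝ)..R, exp (-(1/4 * y)) * ((a y ^ 2 + b y ^ 2) ^ q * (a y ^ 2 + b y ^ 2)) ≤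
      η * (exp (-(1/4 * R)) * (a R ^ 2 + b R ^ 2)) + 8 * (q + 1) ^ 2 / q * η *
      ∫ y in (0:ℝ)..R, exp (-(1/4 * y)) * ((a1 y - a y / 8) ^ 2 + (b1 y - b y / 8) ^ 2) := by
  have ca : Continuous a := continuous_iff_continuousAt.2 fun x => (ha x).continuousAt
  have cb : Continuous b := continuous_iff_continuousAt.2 fun x => (hb x).continuousAt
  have ch : Continuous (fun y => a y ^ 2 + b y ^ 2) := by fun_prop
  have chq : Continuous (fun y => (a y ^ 2 + b y ^ 2) ^ q) :=
    ch.rpow_const fun x => Or.inr hq.le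
  have chq1 : Continuous (fun y => (a y ^ 2 + b y ^ 2) ^ (q + 1 - 1)) := by simpa using chq
  have hF : ∀ x, HasDerivAt (fun x => exp (-(1/4 * x)) * (a x ^ 2 + b x ^ 2) ^ (q + 1)) _ x :=
    fun x => (eder (1/4) x).mul ((hder ha hb x).rpow_const (p := q + 1) (Or.inr (by linarith)))
  have hpow : ∀ x, (a x ^ 2 + b x ^ 2) ^ (q + 1) = (a x ^ 2 + b x ^ 2) ^ q * (a x ^ 2 + b x ^ 2) :=
    fun x => by
      rw [rpow_add_one' (by positivity) (by linarith)]
  have chq2 : Continuous (fun y => (a y ^ 2 + b y ^ 2) ^ (q + 1)) := by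
    simp only [hpow]; fun_prop
  have h1 := int_le_sub (g := fun y => q / 8 * (exp (-(1/4 * y)) * ((a y ^ 2 + b y ^ 2) ^ q *
      (a y ^ 2 + b y ^ 2))) - 8 * (q + 1) ^ 2 / q * η *
      (exp (-(1/4 * y)) * ((a1 y - a y / 8) ^ 2 + (b1 y - b y / 8) ^ 2))) hF (by fun_prop)
      (by fun_prop) hR (by
    intro y hy
    have hηy := hη y hy
    simp only [hpow, add_sub_cancel_right]
    have hH : 0 ≤ (a y ^ 2 + b y ^ 2) ^ q := by positivity
    generalize (a y ^ 2 + b y ^ 2) ^ q = H at *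
    have he := exp_pos (-(1/4 * y))
    generalize exp (-(1/4 * y)) = e at *
    have hz : 0 ≤ (a1 y - a y / 8) ^ 2 + (b1 y - b y / 8) ^ 2 := by positivity
    have h4 : 8 * (q + 1) ^ 2 / q * η * (e * ((a1 y - a y / 8) ^ 2 + (b1 y - b y / 8) ^ 2)) ≥
      8 * (q + 1) ^ 2 / q * H * (e * ((a1 y - a y / 8) ^ 2 + (b1 y - b y / 8) ^ 2)) := by
      gcongr
    obtain ⟨z, hz1⟩ : ∃ z, a1 y = z + a y / 8 := ⟨a1 y - a y / 8, by ring⟩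
    obtain ⟨w, hw1⟩ : ∃ w, b1 y = w + b y / 8 := ⟨b1 y - b y / 8, by ring⟩
    have h6 : z + a y / 8 - a y / 8 = z := by ring
    have h7 : w + b y / 8 - b y / 8 = w := by ring
    rw [hz1, hw1, h6, h7] at h4
    rw [hz1, hw1, h6, h7]
    have h3 : 0 ≤ e * H * (8 / q) * ((q * a y / 8 + (q + 1) * z) ^ 2 +
        (q * b y / 8 + (q + 1) * w) ^ 2) := by positivity
    have h5 : e * H * (8 / q) * ((q * a y / 8 + (q + 1) * z) ^ 2 +
        (q * b y / 8 + (q + 1) * w) ^ 2) = e * H * (q / 8 * (a y ^ 2 + b y ^ 2) +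
         2 * (q + 1) * (a y * z + b y * w)) + 8 * (q + 1) ^ 2 / q * H * (e * (z ^ 2 + w ^ 2)) := by
      field_simp; ring
    nlinarith)
  rw [intervalIntegral.integral_sub (Continuous.intervalIntegrable (by fun_prop) _ _)
    (Continuous.intervalIntegrable (by fun_prop) _ _), intervalIntegral.integral_const_mul,
    intervalIntegral.integral_const_mul] at h1
  simp only [a0, b0, hpow] at h1
  have h2 := mul_le_mul_of_nonneg_right (hη R ⟨hR, le_rfl⟩)
    (show 0 ≤ exp (-(1/4 * R)) * (a R ^ 2 + b R ^ 2) by positivity)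
  have h3 : (0:ℝ) ^ (q + 1) = 0 := zero_rpow (by linarith)
  norm_num [h3] at h1 h2 ⊢
  linarith

lemma weighted_bound (ha : ∀ x, HasDerivAt a (a1 x) x) (hb : ∀ x, HasDerivAt b (b1 x) x)
    (ca1 : Continuous a1) (cb1 : Continuous b1) (a0 : a 0 = 0) (b0 : b 0 = 0) (hR : 0 ≤ R) :
    ∫ x in (0:ℝ)..R, exp (-x) * (a1 x ^ 2 + b1 x ^ 2 + (a x ^ 2 + b x ^ 2)) ≤
      11 * ∫ y in (0:ℝ)..R, exp (-(1/4 * y)) * ((a1 y - a y / 8) ^ 2 + (b1 y - b y / 8) ^ 2) := by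
  have ca : Continuous a := continuous_iff_continuousAt.2 fun x => (ha x).continuousAt
  have cb : Continuous b := continuous_iff_continuousAt.2 fun x => (hb x).continuousAt
  have hs := fun x (hx : x ∈ Set.Icc 0 R) => sup_bound ha hb ca1 cb1 a0 b0 hx
  set A := ∫ y in (0:ℝ)..R, exp (-(1/4 * y)) * ((a1 y - a y / 8) ^ 2 + (b1 y - b y / 8) ^ 2)
    with hA
  have hA0 : 0 ≤ A := intervalIntegral.integral_nonneg hR fun y _ => by positivity
  have h1 : ∫ x in (0:ℝ)..R, exp (-x) * (a1 x ^ 2 + b1 x ^ 2 + (a x ^ 2 + b x ^ 2)) ≤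
    ∫ x in (0:ℝ)..R, (2 * (exp (-(1/4 * x)) * ((a1 x - a x / 8) ^ 2 + (b1 x - b x / 8) ^ 2))
      + (33/32 * (4 * A)) * exp (-(1/2 * x))) := by
    apply intervalIntegral.integral_mono_on hR (Continuous.intervalIntegrable (by fun_prop) _ _)
      (Continuous.intervalIntegrable (by fun_prop) _ _)
    intro x hx
    have h2 := hs x hx
    have h3 : exp (-x) = exp (-(1/2 * x)) * exp (-(1/2 * x)) := by rw [← exp_add]; ring_nf
    have h4 : exp (-x) ≤ exp (-(1/4 * x)) := exp_le_exp.2 (by linarith [hx.1])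
    have h5 : exp (-x) * (a x ^ 2 + b x ^ 2) ≤ 4 * A * exp (-(1/2 * x)) := by
      rw [h3]; nlinarith [exp_pos (-(1/2 * x))]
    have h6 := mul_le_mul_of_nonneg_right h4
      (show 0 ≤ (a1 x - a x / 8) ^ 2 + (b1 x - b x / 8) ^ 2 by positivity)
    have h7 : a1 x ^ 2 + b1 x ^ 2 ≤ 2 * ((a1 x - a x / 8) ^ 2 + (b1 x - b x / 8) ^ 2) +
      1 / 32 * (a x ^ 2 + b x ^ 2) := by
      nlinarith [sq_nonneg (a1 x - a x / 4), sq_nonneg (b1 x - b x / 4)]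
    have h8 := mul_le_mul_of_nonneg_left h7 (exp_pos (-x)).le
    nlinarith
  refine h1.trans ?_
  rw [intervalIntegral.integral_add (Continuous.intervalIntegrable (by fun_prop) _ _)
    (Continuous.intervalIntegrable (by fun_prop) _ _), intervalIntegral.integral_const_mul,
    intervalIntegral.integral_const_mul, ← hA]
  have h9 : ∫ x in (0:ℝ)..R, exp (-(1/2 * x)) ≤ 2 := by
    rw [intervalIntegral.integral_eq_sub_of_hasDerivAt (f := fun x => -2 * exp (-(1/2 * x)))
      (fun x _ => ((eder (1/2) x).const_mul (-2)).congr_deriv (by ring))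
      (Continuous.intervalIntegrable (by fun_prop) _ _)]
    norm_num
    positivity
  nlinarith

set_option maxHeartbeats 2000000 in
lemma coercive (ha : ∀ x, HasDerivAt a (a1 x) x) (hb : ∀ x, HasDerivAt b (b1 x) x)
    (ca1 : Continuous a1) (cb1 : Continuous b1) (a0 : a 0 = 0) (b0 : b 0 = 0) (hR : 1 ≤ R)
    {q η C μ CV E : ℝ} (hq : 0 < q) (_hη0 : 0 ≤ η) (hC : 0 ≤ C) (hμ : 0 ≤ μ)
    (hη : ∀ x ∈ Set.Icc 0 R, (a x ^ 2 + b x ^ 2) ^ q ≤ η)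
    (hE : ∫ x in (0:ℝ)..R, (a1 x ^ 2 + b1 x ^ 2 + (a x ^ 2 + b x ^ 2)) ≤ E)
    {V1 M φ φ1 φ2 : ℝ → ℝ} (cV1 : Continuous V1) (cM : Continuous M) (cφ : Continuous φ)
    (cφ1 : Continuous φ1) (cφ2 : Continuous φ2)
    (hV : ∫ x in (0:ℝ)..R, |V1 x| * exp (1/2 * x) ≤ CV)
    (hM : ∀ x ∈ Set.Icc 0 R, |M x| ≤ 2 * C * ((a x ^ 2 + b x ^ 2) ^ q * (a x ^ 2 + b x ^ 2)))
    (hφ : ∀ x ∈ Set.Icc 0 R, |φ x| ≤ 4)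
    (hφ1 : ∀ x ∈ Set.Icc 0 R, |φ1 x - exp (-(1/4 * x))| ≤ 16 / R)
    (hφ2 : ∀ x ∈ Set.Icc 0 R, |φ2 x + 1/4 * exp (-(1/4 * x))| ≤ 14 / R)
    (k1 : 16 * μ * CV ≤ 1/2) (k2 : 2 * C * (8 / q) * η ≤ 1/8)
    (k3 : 2 * C * (8 / q) * (8 * (q + 1) ^ 2 / q) * η ≤ 1/2) (k4 : 32 * C * η ≤ 1) :
    (∫ y in (0:ℝ)..R, exp (-(1/4 * y)) * ((a1 y - a y / 8) ^ 2 + (b1 y - b y / 8) ^ 2))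
      - 41 * E / R ≤
    ∫ x in (0:ℝ)..R, (2 * φ1 x * (a1 x ^ 2 + b1 x ^ 2) + φ2 x * (a x * a1 x + b x * b1 x)
        - φ x * (μ * V1 x) * (a x ^ 2 + b x ^ 2) + φ1 x * M x) := by
  have hR0 : 0 ≤ R := by linarith
  have ca : Continuous a := continuous_iff_continuousAt.2 fun x => (ha x).continuousAt
  have cb : Continuous b := continuous_iff_continuousAt.2 fun x => (hb x).continuousAt
  have hs := fun x (hx : x ∈ Set.Icc 0 R) => sup_bound ha hb ca1 cb1 a0 b0 hx
  have hk := kmm ha hb ca1 cb1 a0 b0 hR0 hq hη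
  have chq : Continuous (fun y => (a y ^ 2 + b y ^ 2) ^ q) :=
    (show Continuous (fun y => a y ^ 2 + b y ^ 2) by fun_prop).rpow_const fun x => Or.inr hq.le
  set A := ∫ y in (0:ℝ)..R, exp (-(1/4 * y)) * ((a1 y - a y / 8) ^ 2 + (b1 y - b y / 8) ^ 2)
    with hA
  set K := ∫ y in (0:ℝ)..R, exp (-(1/4 * y)) * ((a y ^ 2 + b y ^ 2) ^ q * (a y ^ 2 + b y ^ 2))
    with hK
  set Q := exp (-(1/4 * R)) * (a R ^ 2 + b R ^ 2) with hQ
  have hA0 : 0 ≤ A := intervalIntegral.integral_nonneg hR0 fun y _ => by positivity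
  have hQ0 : 0 ≤ Q := by positivity
  have h1 : ∫ x in (0:ℝ)..R,
      (2 * (exp (-(1/4 * x)) * ((a1 x - a x / 8) ^ 2 + (b1 x - b x / 8) ^ 2))
      + 1/8 * (-(1/4) * exp (-(1/4 * x)) * (a x ^ 2 + b x ^ 2) +
          exp (-(1/4 * x)) * (2 * (a x * a1 x + b x * b1 x)))
      - 41 / R * (a1 x ^ 2 + b1 x ^ 2 + (a x ^ 2 + b x ^ 2))
      - 16 * μ * A * (|V1 x| * exp (1/2 * x))
      - 2 * C * (exp (-(1/4 * x)) * ((a x ^ 2 + b x ^ 2) ^ q * (a x ^ 2 + b x ^ 2)))) ≤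
    ∫ x in (0:ℝ)..R, (2 * φ1 x * (a1 x ^ 2 + b1 x ^ 2) + φ2 x * (a x * a1 x + b x * b1 x)
        - φ x * (μ * V1 x) * (a x ^ 2 + b x ^ 2) + φ1 x * M x) := by
    apply intervalIntegral.integral_mono_on hR0 (Continuous.intervalIntegrable (by fun_prop) _ _)
      (Continuous.intervalIntegrable (by fun_prop) _ _)
    intro x hx
    have g1 := abs_le.1 (hφ1 x hx)
    have g2 := hφ2 x hx
    have g3 := hφ x hx
    have g4 := hM x hx
    have g5 := hη x hx
    have g6 := hs x hx
    have hR' : 0 < R := by linarith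
    have hh : 0 ≤ a x ^ 2 + b x ^ 2 := by positivity
    have hu : 0 ≤ a1 x ^ 2 + b1 x ^ 2 := by positivity
    -- potential term
    have pV : φ x * (μ * V1 x) * (a x ^ 2 + b x ^ 2) ≤ 16 * μ * A * (|V1 x| * exp (1/2 * x)) := by
      have e1 : a x ^ 2 + b x ^ 2 ≤ 4 * A * exp (1/2 * x) := by
        have e2 : exp (-(1/2 * x)) * exp (1/2 * x) = 1 := by rw [← exp_add]; simp
        have := mul_le_mul_of_nonneg_right g6 (exp_pos (1/2 * x)).le
        calc a x ^ 2 + b x ^ 2 = (exp (-(1/2 * x)) * exp (1/2 * x)) * (a x ^ 2 + b x ^ 2) := by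
              rw [e2, one_mul]
          _ = exp (-(1/2 * x)) * (a x ^ 2 + b x ^ 2) * exp (1/2 * x) := by ring
          _ ≤ _ := this
      calc φ x * (μ * V1 x) * (a x ^ 2 + b x ^ 2) ≤ |φ x * (μ * V1 x)| * (a x ^ 2 + b x ^ 2) := by
            gcongr; exact le_abs_self _
        _ = |φ x| * (μ * |V1 x|) * (a x ^ 2 + b x ^ 2) := by
            rw [abs_mul, abs_mul, abs_of_nonneg hμ]
        _ ≤ 4 * (μ * |V1 x|) * (4 * A * exp (1/2 * x)) := by gcongr
        _ = _ := by ring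
    have pu : 2 * φ1 x * (a1 x ^ 2 + b1 x ^ 2) ≥ 2 * exp (-(1/4 * x)) * (a1 x ^ 2 + b1 x ^ 2)
        - 32 * (1 / R) * (a1 x ^ 2 + b1 x ^ 2) := by
      have : 16 / R = 16 * (1 / R) := by ring
      nlinarith
    have px : φ2 x * (a x * a1 x + b x * b1 x) ≥ -(1/4) * exp (-(1/4 * x)) *
        (a x * a1 x + b x * b1 x) - 7 * (1 / R) * (a1 x ^ 2 + b1 x ^ 2 + (a x ^ 2 + b x ^ 2)) := by
      have e1 : |a x * a1 x + b x * b1 x| ≤ 1/2 * (a1 x ^ 2 + b1 x ^ 2 + (a x ^ 2 + b x ^ 2)) := by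
        rw [abs_le]; constructor <;>
        nlinarith [sq_nonneg (a x - a1 x), sq_nonneg (a x + a1 x), sq_nonneg (b x - b1 x),
          sq_nonneg (b x + b1 x)]
      have e2 := neg_abs_le ((φ2 x + 1/4 * exp (-(1/4 * x))) * (a x * a1 x + b x * b1 x))
      have e3 : |(φ2 x + 1/4 * exp (-(1/4 * x))) * (a x * a1 x + b x * b1 x)| ≤
          14 / R * (1/2 * (a1 x ^ 2 + b1 x ^ 2 + (a x ^ 2 + b x ^ 2))) := by
        rw [abs_mul]; gcongr
      have e4 : 14 / R * (1/2 * (a1 x ^ 2 + b1 x ^ 2 + (a x ^ 2 + b x ^ 2))) =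
        7 * (1 / R) * (a1 x ^ 2 + b1 x ^ 2 + (a x ^ 2 + b x ^ 2)) := by ring
      linarith
    have pM : φ1 x * M x ≥ - (2 * C * (exp (-(1/4 * x)) *
        ((a x ^ 2 + b x ^ 2) ^ q * (a x ^ 2 + b x ^ 2)))) - (1 / R) * (a x ^ 2 + b x ^ 2) := by
      have e1 : |φ1 x| ≤ exp (-(1/4 * x)) + 16 / R := by
        have := exp_pos (-(1/4 * x))
        have : 0 < 16 / R := by positivity
        rw [abs_le]; constructor <;> linarith
      have e2 := neg_abs_le (φ1 x * M x)
      have e3 : |φ1 x * M x| ≤ (exp (-(1/4 * x)) + 16 / R) *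
          (2 * C * ((a x ^ 2 + b x ^ 2) ^ q * (a x ^ 2 + b x ^ 2))) := by
        rw [abs_mul]; gcongr
      have e4 : 16 / R * (2 * C * ((a x ^ 2 + b x ^ 2) ^ q * (a x ^ 2 + b x ^ 2))) ≤
          16 / R * (2 * C * (η * (a x ^ 2 + b x ^ 2))) := by gcongr
      have e5 : 16 / R * (2 * C * (η * (a x ^ 2 + b x ^ 2))) =
         (32 * C * η) * ((1 / R) * (a x ^ 2 + b x ^ 2)) := by ring
      have e6 : (32 * C * η) * ((1 / R) * (a x ^ 2 + b x ^ 2)) ≤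
          1 * ((1 / R) * (a x ^ 2 + b x ^ 2)) := by gcongr
      linarith
    have hr : 0 ≤ 1 / R := by positivity
    have e7 : 41 / R = 41 * (1 / R) := by ring
    have e8 := mul_nonneg hr hh
    have e9 := mul_nonneg hr hu
    rw [e7]
    generalize 1 / R = r at *
    linarith
  refine le_trans ?_ h1
  rw [intervalIntegral.integral_sub (Continuous.intervalIntegrable (by fun_prop) _ _)
    (Continuous.intervalIntegrable (by fun_prop) _ _),
    intervalIntegral.integral_sub (Continuous.intervalIntegrable (by fun_prop) _ _)
    (Continuous.intervalIntegrable (by fun_prop) _ _),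
    intervalIntegral.integral_sub (Continuous.intervalIntegrable (by fun_prop) _ _)
    (Continuous.intervalIntegrable (by fun_prop) _ _),
    intervalIntegral.integral_add (Continuous.intervalIntegrable (by fun_prop) _ _)
    (Continuous.intervalIntegrable (by fun_prop) _ _)]
  simp only [intervalIntegral.integral_const_mul]
  rw [← hA, ← hK]
  have hQint : ∫ x in (0:ℝ)..R, (-(1/4) * exp (-(1/4 * x)) * (a x ^ 2 + b x ^ 2) +
          exp (-(1/4 * x)) * (2 * (a x * a1 x + b x * b1 x))) = Q := by
    rw [intervalIntegral.integral_eq_sub_of_hasDerivAt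
      (f := fun x => exp (-(1/4 * x)) * (a x ^ 2 + b x ^ 2))
      (fun x _ => (eder (1/4) x).mul (hder ha hb x))
      (Continuous.intervalIntegrable (by fun_prop) _ _)]
    simp [a0, b0, hQ]
  rw [hQint]
  have f1 : 41 / R * ∫ x in (0:ℝ)..R, (a1 x ^ 2 + b1 x ^ 2 + (a x ^ 2 + b x ^ 2)) ≤ 41 * E / R := by
    calc _ ≤ 41 / R * E := by gcongr
      _ = _ := by ring
  have f2 : 16 * μ * A * ∫ x in (0:ℝ)..R, |V1 x| * exp (1/2 * x) ≤ 1/2 * A := by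
    calc _ ≤ 16 * μ * A * CV := by gcongr
      _ = (16 * μ * CV) * A := by ring
      _ ≤ _ := by gcongr
  have f3 : 2 * C * K ≤ 1/8 * Q + 1/2 * A := by
    calc 2 * C * K = 2 * C * (8 / q) * (q / 8 * K) := by field_simp
      _ ≤ 2 * C * (8 / q) * (η * Q + 8 * (q + 1) ^ 2 / q * η * A) := by gcongr
      _ = (2 * C * (8 / q) * η) * Q + (2 * C * (8 / q) * (8 * (q + 1) ^ 2 / q) * η) * A := by ring
      _ ≤ _ := by gcongr
  linarith

end fixed

/-- The truncated multiplier. -/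
lemma mult (R : ℝ) (hR : 1 ≤ R) : ∃ φ φ1 φ2 : ℝ → ℝ, (∀ x, HasDerivAt φ (φ1 x) x) ∧
    (∀ x, HasDerivAt φ1 (φ2 x) x) ∧ Continuous φ2 ∧ φ 0 = 0 ∧ φ R = 0 ∧ φ1 R = 0 ∧
    (∀ x ∈ Set.Icc 0 R, |φ x| ≤ 4) ∧
    (∀ x ∈ Set.Icc 0 R, |φ1 x - exp (-(1/4 * x))| ≤ 16 / R) ∧
    (∀ x ∈ Set.Icc 0 R, |φ2 x + 1/4 * exp (-(1/4 * x))| ≤ 14 / R) := by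
  have hR' : 0 < R := by linarith
  have d1 : ∀ x : ℝ, HasDerivAt (fun x => 4 * (1 - exp (-(1/4 * x)))) (exp (-(1/4 * x))) x :=
    fun x => (((eder (1/4) x).const_sub 1).const_mul 4).congr_deriv (by ring)
  have d2 : ∀ x : ℝ, HasDerivAt (fun x => (1 - x / R) ^ 2) (-(2 / R * (1 - x / R))) x := fun x =>
    ((((hasDerivAt_id x).div_const R).const_sub 1).pow 2).congr_deriv (by simp; ring)
  have d3 : ∀ x : ℝ, HasDerivAt (fun x => -(2 / R * (1 - x / R))) (2 / R ^ 2) x := fun x =>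
    ((((hasDerivAt_id x).div_const R).const_sub 1).const_mul (2/R)).neg.congr_deriv
      (by field_simp)
  refine ⟨_, _, _, fun x => (d1 x).mul (d2 x),
    fun x => ((eder (1/4) x).mul (d2 x)).add ((d1 x).mul (d3 x)), by fun_prop, by simp,
    by simp [hR'.ne'], by simp [hR'.ne'], ?_, ?_, ?_⟩
  all_goals
    intro x hx
    have h0 := exp_pos (-(1/4 * x))
    have h1 : exp (-(1/4 * x)) ≤ 1 := by rw [exp_le_one_iff]; linarith [hx.1]
    have h2 : exp (-(1/4 * x)) * x ≤ 4 := by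
      have : exp (-(1/4 * x)) * exp (1/4 * x) = 1 := by rw [← exp_add]; simp
      have := add_one_le_exp (1/4 * x)
      nlinarith [hx.1]
    obtain ⟨r, hr⟩ : ∃ r, r = 1 / R := ⟨_, rfl⟩
    have hr0 : 0 < r := by rw [hr]; positivity
    have hr1 : r ≤ 1 := by rw [hr, div_le_one hR']; exact hR
    have s1 : x / R = x * r := by rw [hr]; ring
    have s2 : 2 / R = 2 * r := by rw [hr]; ring
    have s3 : 16 / R = 16 * r := by rw [hr]; ring
    have s4 : 14 / R = 14 * r := by rw [hr]; ring
    have s5 : 2 / R ^ 2 = 2 * r * r := by rw [hr]; field_simp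
    have hy0 : 0 ≤ x * r := mul_nonneg hx.1 hr0.le
    have hy1 : x * r ≤ 1 := by rw [← s1, div_le_one hR']; exact hx.2
    have h3 : exp (-(1/4 * x)) * (x * r) ≤ 4 * r := by nlinarith
    simp only [Pi.mul_apply, s1, s2, s3, s4, s5]
    have h30 : 0 ≤ exp (-(1/4 * x)) * (x * r) := by positivity
    generalize exp (-(1/4 * x)) = e at *
    generalize hy : x * r = y at *
  · have : 0 ≤ (1 - y) ^ 2 ∧ (1 - y) ^ 2 ≤ 1 := ⟨by positivity, by nlinarith⟩
    rw [abs_mul, abs_of_nonneg this.1, abs_of_nonneg (by linarith)]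
    nlinarith
  · rw [abs_le]
    have p1 : 0 ≤ (1 - e) * (r * (1 - y)) := by
      apply mul_nonneg; linarith; apply mul_nonneg <;> linarith
    have p2 : (1 - e) * (r * (1 - y)) ≤ r := by
      calc _ ≤ 1 * (r * 1) := by gcongr <;> linarith
        _ = r := by ring
    have p3 : 0 ≤ e * y * y := by positivity
    have p4 : e * y * y ≤ e * y := by nlinarith
    constructor <;> nlinarith
  · rw [abs_le]
    have p3 : 0 ≤ e * y * y := by positivity
    have p4 : e * y * y ≤ e * y := by nlinarith
    have p5 : 0 ≤ e * (r * (1 - y)) := by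
      apply mul_nonneg; linarith; apply mul_nonneg <;> linarith
    have p6 : e * (r * (1 - y)) ≤ r := by
      calc _ ≤ 1 * (r * 1) := by gcongr; linarith
        _ = r := by ring
    have p7 : 0 ≤ (1 - e) * (r * r) := by
      apply mul_nonneg; linarith; positivity
    have p8 : (1 - e) * (r * r) ≤ r := by
      calc _ ≤ 1 * (r * 1) := by gcongr; linarith
        _ = r := by ring
    constructor <;> nlinarith

lemma contN {a b c d : ℝ → ℝ} {f : ℝ → ℝ} {C q : ℝ} (hq : 0 < q)
    (hf : ∀ s : ℝ, 0 ≤ s → |f s| ≤ C * s ^ q)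
    (ca : Continuous a) (cb : Continuous b) (cc : Continuous c) (cd : Continuous d)
    (h1 : ∀ x, c x = f (a x ^ 2 + b x ^ 2) * a x) (h2 : ∀ x, d x = f (a x ^ 2 + b x ^ 2) * b x) :
    Continuous (fun x => f (a x ^ 2 + b x ^ 2)) := by
  have ch : Continuous (fun x => a x ^ 2 + b x ^ 2) := by fun_prop
  rw [continuous_iff_continuousAt]
  intro x
  by_cases hx : a x ^ 2 + b x ^ 2 = 0
  · have hfx : f (a x ^ 2 + b x ^ 2) = 0 := by
      have := hf 0 le_rfl
      rw [zero_rpow hq.ne', mul_zero] at this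
      rw [hx]; exact abs_nonpos_iff.1 this
    unfold ContinuousAt
    simp only [hfx]
    have hlim : Filter.Tendsto (fun y => C * (a y ^ 2 + b y ^ 2) ^ q) (nhds x) (nhds 0) := by
      have : Continuous (fun y => C * (a y ^ 2 + b y ^ 2) ^ q) :=
        continuous_const.mul (ch.rpow_const fun x => Or.inr hq.le)
      have h := this.tendsto x
      simpa [hx, zero_rpow hq.ne'] using h
    exact squeeze_zero_norm (fun y => hf _ (by positivity)) hlim
  · have hev : ∀ᶠ y in nhds x, a y ^ 2 + b y ^ 2 ≠ 0 := ch.continuousAt.eventually_ne hx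
    have : ContinuousAt (fun y => (c y * a y + d y * b y) / (a y ^ 2 + b y ^ 2)) x :=
      ContinuousAt.div (by fun_prop) (by fun_prop) hx
    refine this.congr ?_
    filter_upwards [hev] with y hy
    rw [h1, h2]; field_simp

lemma contOn_image {f h : ℝ → ℝ} (hc : Continuous h) (hfh : Continuous (fun x => f (h x)))
    {K : Set ℝ} (hK : IsCompact K) : ContinuousOn f (h '' K) := by
  rw [continuousOn_iff_isClosed]
  intro t ht
  refine ⟨h '' ((fun x => f (h x)) ⁻¹' t ∩ K), ?_, ?_⟩
  · exact ((hK.inter_left (ht.preimage hfh)).image hc).isClosed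
  · ext y
    constructor
    · rintro ⟨hy, x, hx, rfl⟩
      exact ⟨⟨x, ⟨hy, hx⟩, rfl⟩, ⟨x, hx, rfl⟩⟩
    · rintro ⟨⟨x, ⟨hy, hx⟩, rfl⟩, _⟩
      exact ⟨hy, ⟨x, hx, rfl⟩⟩

lemma G_bound {f h h' : ℝ → ℝ} {C q : ℝ} (hC : 0 ≤ C) (hq : 0 < q)
    (hf : ∀ s : ℝ, 0 ≤ s → |f s| ≤ C * s ^ q)
    (hh : ∀ x, HasDerivAt h (h' x) x) (ch' : Continuous h') (h0 : h 0 = 0) (hpos : ∀ x, 0 ≤ h x)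
    (hfh : Continuous (fun x => f (h x))) (x : ℝ) :
    |∫ y in (0:ℝ)..x, f (h y) * h' y| ≤ C * (h x ^ q * h x) := by
  have ch : Continuous h := continuous_iff_continuousAt.2 fun x => (hh x).continuousAt
  have e : ∫ y in (0:ℝ)..x, f (h y) * h' y = ∫ s in (h 0)..(h x), f s :=
    intervalIntegral.integral_comp_mul_deriv' (g := f) (fun x _ => hh x) ch'.continuousOn
      (contOn_image ch hfh isCompact_uIcc)
  rw [e, h0]
  have := intervalIntegral.norm_integral_le_of_norm_le_const (f := f) (a := 0) (b := h x)
    (C := C * h x ^ q) (by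
      intro s hs
      rw [Set.uIoc_of_le (hpos x)] at hs
      refine (hf s hs.1.le).trans ?_
      gcongr
      · exact hs.1.le
      · exact hs.2)
  rw [sub_zero, abs_of_nonneg (hpos x), norm_eq_abs] at this
  linarith

lemma param_deriv {F F' : ℝ → ℝ → ℝ} (cF : Continuous (Function.uncurry F))
    (cF' : Continuous (Function.uncurry F')) (h : ∀ t x, HasDerivAt (fun s => F s x) (F' t x) t)
    (R t : ℝ) :
    HasDerivAt (fun t => ∫ x in (0:ℝ)..R, F t x) (∫ x in (0:ℝ)..R, F' t x) t := by
  obtain ⟨K, hK⟩ := ((isCompact_Icc (a := t - 1) (b := t + 1)).prod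
    (isCompact_uIcc (a := (0:ℝ)) (b := R))).exists_bound_of_continuousOn cF'.continuousOn
  have c1 : ∀ s, Continuous (F s) := fun s => cF.comp (by fun_prop : Continuous fun x => (s, x))
  have c2 : ∀ s, Continuous (F' s) := fun s => cF'.comp (by fun_prop : Continuous fun x => (s, x))
  refine (intervalIntegral.hasDerivAt_integral_of_dominated_loc_of_deriv_le
    (s := Set.Icc (t - 1) (t + 1)) (bound := fun _ => K) (Icc_mem_nhds (by linarith) (by linarith))
    (Filter.Eventually.of_forall fun s => (c1 s).aestronglyMeasurable)
    ((c1 t).intervalIntegrable _ _) (c2 t).aestronglyMeasurable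
    (Filter.Eventually.of_forall fun x hx s hs => hK (s, x) ⟨hs, Set.uIoc_subset_uIcc hx⟩)
    (by simp) (Filter.Eventually.of_forall fun x _ s _ => h s x)).2

section partials
variable {E : Type*} [NormedAddCommGroup E] [NormedSpace ℝ E]

/-- partial derivative in time -/
noncomputable def Dt (A : ℝ × ℝ → E) (p : ℝ × ℝ) : E := fderiv ℝ A p (1, 0)
/-- partial derivative in space -/
noncomputable def Dx (A : ℝ × ℝ → E) (p : ℝ × ℝ) : E := fderiv ℝ A p (0, 1)

lemma Dt_smooth {A : ℝ × ℝ → E} (hA : ContDiff ℝ (⊤ : ℕ∞) A) : ContDiff ℝ (⊤ : ℕ∞) (Dt A) :=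
  (hA.fderiv_right (m := (⊤ : ℕ∞)) (by simp)).clm_apply contDiff_const

lemma Dx_smooth {A : ℝ × ℝ → E} (hA : ContDiff ℝ (⊤ : ℕ∞) A) : ContDiff ℝ (⊤ : ℕ∞) (Dx A) :=
  (hA.fderiv_right (m := (⊤ : ℕ∞)) (by simp)).clm_apply contDiff_const

lemma Dt_has {A : ℝ × ℝ → E} (hA : ContDiff ℝ (⊤ : ℕ∞) A) (t x : ℝ) :
    HasDerivAt (fun s => A (s, x)) (Dt A (t, x)) t := by
  have h := ((hA.differentiable (by simp)) (t, x)).hasFDerivAt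
  exact h.comp_hasDerivAt t ((hasDerivAt_id t).prodMk (hasDerivAt_const t x))

lemma Dx_has {A : ℝ × ℝ → E} (hA : ContDiff ℝ (⊤ : ℕ∞) A) (t x : ℝ) :
    HasDerivAt (fun y => A (t, y)) (Dx A (t, x)) x := by
  have h := ((hA.differentiable (by simp)) (t, x)).hasFDerivAt
  exact h.comp_hasDerivAt x ((hasDerivAt_const x t).prodMk (hasDerivAt_id x))

lemma Dtx {A : ℝ × ℝ → E} (hA : ContDiff ℝ (⊤ : ℕ∞) A) (p : ℝ × ℝ) :
    Dt (Dx A) p = Dx (Dt A) p := by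
  have hs : IsSymmSndFDerivAt ℝ A p :=
    (hA.contDiffAt (x := p)).isSymmSndFDerivAt (by
      rw [minSmoothness_of_isRCLikeNormedField]; exact WithTop.coe_le_coe.2 le_top)
  have hd : DifferentiableAt ℝ (fderiv ℝ A) p :=
    (hA.fderiv_right (m := (⊤ : ℕ∞)) (by simp)).differentiable (by simp) p
  have e : ∀ v w : ℝ × ℝ, fderiv ℝ (fun p => fderiv ℝ A p v) p w = fderiv ℝ (fderiv ℝ A) p w v := by
    intro v w
    rw [fderiv_clm_apply hd (differentiableAt_const v)]
    simp
  unfold Dt Dx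
  rw [e, e]
  exact hs _ _

end partials

lemma slab {p C₀ : ℝ} (hp1 : 1 < p) (hC0 : 0 ≤ C₀)
    {f : ℝ → ℝ} (hf : ∀ s : ℝ, 0 ≤ s → |f s| ≤ C₀ * s ^ ((p - 1) / 2))
    (V : SchwartzMap ℝ ℝ) {CV : ℝ}
    (hCV : ∀ R, 0 ≤ R → ∫ x in (0:ℝ)..R, |deriv (V : ℝ → ℝ) x| * exp (1/2 * x) ≤ CV)
    {a b : ℝ × ℝ → ℝ} (ha : ContDiff ℝ (⊤ : ℕ∞) a) (hb : ContDiff ℝ (⊤ : ℕ∞) b)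
    {μ ε η q : ℝ} (hq : q = (p - 1) / 2) (hμ : 0 ≤ μ) (hη : η = (ε ^ 2) ^ q)
    (e1 : ∀ t x, - Dt b (t, x) + Dx (Dx a) (t, x) =
      (μ * V x + f (a (t, x) ^ 2 + b (t, x) ^ 2)) * a (t, x))
    (e2 : ∀ t x, Dt a (t, x) + Dx (Dx b) (t, x) =
      (μ * V x + f (a (t, x) ^ 2 + b (t, x) ^ 2)) * b (t, x))
    (a0 : ∀ t, a (t, 0) = 0) (b0 : ∀ t, b (t, 0) = 0)
    (hE : ∀ t R, 0 ≤ R → ∫ x in (0:ℝ)..R, (Dx a (t, x) ^ 2 + Dx b (t, x) ^ 2 +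
      (a (t, x) ^ 2 + b (t, x) ^ 2)) ≤ ε ^ 2)
    (k1 : 16 * μ * CV ≤ 1/2) (k2 : 2 * C₀ * (8 / q) * η ≤ 1/8)
    (k3 : 2 * C₀ * (8 / q) * (8 * (q + 1) ^ 2 / q) * η ≤ 1/2) (k4 : 32 * C₀ * η ≤ 1)
    {R T : ℝ} (hR : 1 ≤ R) (hT : 0 ≤ T) :
    ∫ t in (0:ℝ)..T, ∫ x in (0:ℝ)..R, exp (-x) * (Dx a (t, x) ^ 2 + Dx b (t, x) ^ 2 +
      (a (t, x) ^ 2 + b (t, x) ^ 2)) ≤ 11 * (4 * ε ^ 2 + 41 * ε ^ 2 / R * T) := by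
  have hq0 : 0 < q := by rw [hq]; linarith
  have hR0 : 0 ≤ R := by linarith
  rw [← hq] at hf
  have sec : ∀ t : ℝ, Continuous (fun x : ℝ => (t, x)) := fun t => by fun_prop
  have ca := ha.continuous
  have cb := hb.continuous
  have ha1 := Dx_smooth ha
  have hb1 := Dx_smooth hb
  have hat := Dt_smooth ha
  have hbt := Dt_smooth hb
  have ca1 := ha1.continuous
  have cb1 := hb1.continuous
  have ca2 := (Dx_smooth ha1).continuous
  have cb2 := (Dx_smooth hb1).continuous
  have cat := hat.continuous
  have cbt := hbt.continuous
  have catx := (Dx_smooth hat).continuous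
  have cbtx := (Dx_smooth hbt).continuous
  have cV := V.continuous
  have hVd : ∀ x, HasDerivAt V (deriv (V : ℝ → ℝ) x) x := fun x =>
    (V.differentiableAt).hasDerivAt
  have cV1 : Continuous (deriv (V : ℝ → ℝ)) := (V.smooth 1).continuous_deriv le_rfl
  obtain ⟨φ, φ1, φ2, hφ, hφ1, cφ2, φ0, φR, φ1R, bφ, bφ1, bφ2⟩ := mult R hR
  have cφ : Continuous φ := continuous_iff_continuousAt.2 fun x => (hφ x).continuousAt
  have cφ1 : Continuous φ1 := continuous_iff_continuousAt.2 fun x => (hφ1 x).continuousAt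
  -- pointwise bound
  have hsup : ∀ t x, x ∈ Set.Icc 0 R → a (t, x) ^ 2 + b (t, x) ^ 2 ≤ ε ^ 2 := by
    intro t x hx
    have h := int_le_sub (F := fun x => -(a (t, x) ^ 2 + b (t, x) ^ 2))
      (g := fun x => -(Dx a (t, x) ^ 2 + Dx b (t, x) ^ 2 + (a (t, x) ^ 2 + b (t, x) ^ 2)))
      (fun x => (hder (Dx_has ha t) (Dx_has hb t) x).neg) (by fun_prop) (by fun_prop) hx.1 (by
        intro y _
        nlinarith [sq_nonneg (a (t, y) - Dx a (t, y)), sq_nonneg (b (t, y) - Dx b (t, y))])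
    rw [intervalIntegral.integral_neg] at h
    simp only [a0, b0] at h
    have := hE t x hx.1
    norm_num at h
    linarith
  have hηb : ∀ t x, x ∈ Set.Icc 0 R → (a (t, x) ^ 2 + b (t, x) ^ 2) ^ q ≤ η := by
    intro t x hx
    rw [hη]
    exact rpow_le_rpow (by positivity) (hsup t x hx) hq0.le
  have hη0 : 0 ≤ η := by rw [hη]; positivity
  -- lower bound for the derivative
  have low : ∀ t, 1 / 11 * (∫ x in (0:ℝ)..R, exp (-x) * (Dx a (t, x) ^ 2 + Dx b (t, x) ^ 2 +
      (a (t, x) ^ 2 + b (t, x) ^ 2))) - 41 * ε ^ 2 / R ≤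
      ∫ x in (0:ℝ)..R, φ x * (Dt a (t, x) * Dx b (t, x) + a (t, x) * Dx (Dt b) (t, x)
        - Dt b (t, x) * Dx a (t, x) - b (t, x) * Dx (Dt a) (t, x)) := by
    intro t
    have cN : Continuous (fun x => f (a (t, x) ^ 2 + b (t, x) ^ 2)) :=
      contN (a := fun x => a (t, x)) (b := fun x => b (t, x))
        (c := fun x => - Dt b (t, x) + Dx (Dx a) (t, x) - μ * V x * a (t, x))
        (d := fun x => Dt a (t, x) + Dx (Dx b) (t, x) - μ * V x * b (t, x)) hq0 hf
        (by fun_prop) (by fun_prop) (by fun_prop) (by fun_prop)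
        (fun x => by linarith [e1 t x]) (fun x => by linarith [e2 t x])
    have hd := hder (Dx_has ha t) (Dx_has hb t)
    set G : ℝ → ℝ := fun x => ∫ y in (0:ℝ)..x, f (a (t, y) ^ 2 + b (t, y) ^ 2) *
      (2 * (a (t, y) * Dx a (t, y) + b (t, y) * Dx b (t, y))) with hGdef
    have hG : ∀ x, HasDerivAt G (f (a (t, x) ^ 2 + b (t, x) ^ 2) *
        (2 * (a (t, x) * Dx a (t, x) + b (t, x) * Dx b (t, x)))) x := fun x =>
      intervalIntegral.integral_hasDerivAt_right
        (Continuous.intervalIntegrable (cN.mul (by fun_prop)) _ _)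
        (Continuous.stronglyMeasurableAtFilter (cN.mul (by fun_prop)) _ _)
        (Continuous.continuousAt (cN.mul (by fun_prop)))
    have cG : Continuous G := continuous_iff_continuousAt.2 fun x => (hG x).continuousAt
    have hGb : ∀ x, |G x| ≤ C₀ * ((a (t, x) ^ 2 + b (t, x) ^ 2) ^ q *
        (a (t, x) ^ 2 + b (t, x) ^ 2)) := fun x =>
      G_bound (h := fun x => a (t, x) ^ 2 + b (t, x) ^ 2) hC0 hq0 hf hd (by fun_prop)
        (by simp [a0, b0]) (fun x => by positivity) cN x
    rw [virial_id (a := fun x => a (t, x)) (b := fun x => b (t, x)) (a1 := fun x => Dx a (t, x))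
      (b1 := fun x => Dx b (t, x)) (a2 := fun x => Dx (Dx a) (t, x))
      (b2 := fun x => Dx (Dx b) (t, x)) (at' := fun x => Dt a (t, x)) (bt := fun x => Dt b (t, x))
      (atx := fun x => Dx (Dt a) (t, x)) (btx := fun x => Dx (Dt b) (t, x))
      (N := fun x => f (a (t, x) ^ 2 + b (t, x) ^ 2)) (G := G) (P := fun x => μ * V x)
      (P1 := fun x => μ * deriv (V : ℝ → ℝ) x)
      (Dx_has ha t) (Dx_has hb t) (Dx_has ha1 t) (Dx_has hb1 t) (Dx_has hat t) (Dx_has hbt t)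
      hG (fun x => (hVd x).const_mul μ) hφ hφ1 (by fun_prop) (by fun_prop) cN (by fun_prop) cφ2
      (e1 t) (e2 t) (a0 t) (b0 t) φ0 φR φ1R]
    have hc := coercive (a := fun x => a (t, x)) (b := fun x => b (t, x))
      (M := fun x => f (a (t, x) ^ 2 + b (t, x) ^ 2) * (a (t, x) ^ 2 + b (t, x) ^ 2) - G x)
      (Dx_has ha t) (Dx_has hb t) (by fun_prop)
      (by fun_prop) (a0 t) (b0 t) hR hq0 hη0 hC0 hμ (hηb t) (hE t R hR0) cV1
      ((cN.mul (by fun_prop)).sub cG) cφ cφ1 cφ2 (hCV R hR0) (by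
        intro x hx
        have h1 := hf (a (t, x) ^ 2 + b (t, x) ^ 2) (by positivity)
        have h2 := hGb x
        have h3 := abs_sub (f (a (t, x) ^ 2 + b (t, x) ^ 2) * (a (t, x) ^ 2 + b (t, x) ^ 2)) (G x)
        rw [abs_mul, abs_of_nonneg (show 0 ≤ a (t, x) ^ 2 + b (t, x) ^ 2 by positivity)] at h3
        have h4 := mul_le_mul_of_nonneg_right h1
          (show 0 ≤ a (t, x) ^ 2 + b (t, x) ^ 2 by positivity)
        linarith) bφ bφ1 bφ2 k1 k2 k3 k4
    have hw := weighted_bound (Dx_has ha t) (Dx_has hb t) (by fun_prop)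
      (by fun_prop) (a0 t) (b0 t) hR0
    linarith
  -- the virial functional
  set J : ℝ → ℝ := fun t => ∫ x in (0:ℝ)..R, φ x * (a (t, x) * Dx b (t, x) - b (t, x) * Dx a (t, x))
    with hJ
  have hJd : ∀ t, HasDerivAt J (∫ x in (0:ℝ)..R, φ x * (Dt a (t, x) * Dx b (t, x) +
      a (t, x) * Dx (Dt b) (t, x) - Dt b (t, x) * Dx a (t, x) - b (t, x) * Dx (Dt a) (t, x))) t := by
    intro t
    refine param_deriv (F := fun t x => φ x * (a (t, x) * Dx b (t, x) - b (t, x) * Dx a (t, x)))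
      (F' := fun t x => φ x * (Dt a (t, x) * Dx b (t, x) +
      a (t, x) * Dx (Dt b) (t, x) - Dt b (t, x) * Dx a (t, x) - b (t, x) * Dx (Dt a) (t, x)))
      (by unfold Function.uncurry; fun_prop) (by unfold Function.uncurry; fun_prop) ?_ R t
    intro t x
    refine ((((Dt_has ha t x).mul (Dt_has hb1 t x)).sub
      ((Dt_has hb t x).mul (Dt_has ha1 t x))).const_mul (φ x)).congr_deriv ?_
    rw [Dtx ha, Dtx hb]; ring
  have hJb : ∀ t, |J t| ≤ 2 * ε ^ 2 := by
    intro t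
    have h1 : ‖J t‖ ≤ ∫ x in (0:ℝ)..R, 2 * (Dx a (t, x) ^ 2 + Dx b (t, x) ^ 2 +
      (a (t, x) ^ 2 + b (t, x) ^ 2)) := by
      apply intervalIntegral.norm_integral_le_of_norm_le hR0
      · refine Filter.Eventually.of_forall fun x hx => ?_
        rw [norm_mul, norm_eq_abs, norm_eq_abs]
        have h2 := bφ x ⟨hx.1.le, hx.2⟩
        have h3 : |a (t, x) * Dx b (t, x) - b (t, x) * Dx a (t, x)| ≤
          1/2 * (Dx a (t, x) ^ 2 + Dx b (t, x) ^ 2 + (a (t, x) ^ 2 + b (t, x) ^ 2)) := by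
          rw [abs_le]; constructor <;>
          nlinarith [sq_nonneg (a (t, x) - Dx b (t, x)), sq_nonneg (a (t, x) + Dx b (t, x)),
            sq_nonneg (b (t, x) - Dx a (t, x)), sq_nonneg (b (t, x) + Dx a (t, x))]
        calc _ ≤ 4 * (1/2 * (Dx a (t, x) ^ 2 + Dx b (t, x) ^ 2 +
              (a (t, x) ^ 2 + b (t, x) ^ 2))) := by gcongr
          _ = _ := by ring
      · exact Continuous.intervalIntegrable (by fun_prop) _ _
    rw [intervalIntegral.integral_const_mul] at h1
    have := hE t R hR0
    rw [norm_eq_abs] at h1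
    linarith
  have cB : Continuous (fun t => ∫ x in (0:ℝ)..R, exp (-x) * (Dx a (t, x) ^ 2 + Dx b (t, x) ^ 2 +
      (a (t, x) ^ 2 + b (t, x) ^ 2))) :=
    intervalIntegral.continuous_parametric_intervalIntegral_of_continuous'
      (by unfold Function.uncurry; fun_prop) _ _
  have cJ : Continuous (fun t => ∫ x in (0:ℝ)..R, φ x * (Dt a (t, x) * Dx b (t, x) +
      a (t, x) * Dx (Dt b) (t, x) - Dt b (t, x) * Dx a (t, x) - b (t, x) * Dx (Dt a) (t, x))) :=
    intervalIntegral.continuous_parametric_intervalIntegral_of_continuous'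
      (by unfold Function.uncurry; fun_prop) _ _
  have fin := int_le_sub hJd cJ (by fun_prop) hT (fun t _ => low t)
  rw [intervalIntegral.integral_sub (Continuous.intervalIntegrable (by fun_prop) _ _)
    (Continuous.intervalIntegrable (by fun_prop) _ _), intervalIntegral.integral_const_mul] at fin
  simp only [intervalIntegral.integral_const, sub_zero, smul_eq_mul] at fin
  have j1 := abs_le.1 (hJb T)
  have j2 := abs_le.1 (hJb 0)
  linarith

lemma DL (L : ℂ →L[ℝ] ℝ) {U : ℝ × ℝ → ℂ} (hU : ContDiff ℝ (⊤ : ℕ∞) U) :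
    Dx (fun p => L (U p)) = (fun p => L (Dx U p)) ∧ Dt (fun p => L (U p)) = (fun p => L (Dt U p)) := by
  constructor <;> funext p <;>
  · simp only [Dx, Dt]
    have h := L.hasFDerivAt.comp p ((hU.differentiable (by simp)) p).hasFDerivAt
    have h' : HasFDerivAt (fun p => L (U p)) (L.comp (fderiv ℝ U p)) p := h
    rw [h'.fderiv]; rfl

lemma fatou_step {k : ℝ → ℝ → ℝ} {C : ℝ}
    (ck : Continuous (Function.uncurry k)) (hk0 : ∀ t x, 0 ≤ k t x)
    (hki : ∀ t, Integrable (k t)) (heven : ∀ t x, k t (-x) = k t x)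
    (hb : ∀ n : ℕ, ∫ t in (0:ℝ)..(n + 1 : ℝ), ∫ x in (0:ℝ)..(n + 1 : ℝ), k t x ≤ C) :
    ∫⁻ t in Set.Ici (0:ℝ), ENNReal.ofReal (∫ x, k t x) ≤ ENNReal.ofReal (2 * C) := by
  set B : ℕ → ℝ → ℝ := fun n t => ∫ x in (0:ℝ)..(n + 1 : ℝ), k t x with hB
  have cB : ∀ n, Continuous (B n) := fun n =>
    intervalIntegral.continuous_parametric_intervalIntegral_of_continuous' ck _ _
  have hn0 : ∀ n : ℕ, (0:ℝ) ≤ n + 1 := fun n => by positivity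
  have B0 : ∀ n t, 0 ≤ B n t := fun n t =>
    intervalIntegral.integral_nonneg (hn0 n) fun x _ => hk0 t x
  have hatTop : Filter.Tendsto (fun n : ℕ => (n + 1 : ℝ)) Filter.atTop Filter.atTop :=
    Filter.tendsto_atTop_add_const_right _ _ tendsto_natCast_atTop_atTop
  have hfull : ∀ t, ∫ x, k t x = 2 * ∫ x in Set.Ioi (0:ℝ), k t x := by
    intro t
    rw [← integral_comp_abs]
    congr 1; funext x
    rcases abs_choice x with h | h <;> rw [h]
    rw [heven]
  set g : ℕ → ℝ → ENNReal := fun n => Set.indicator (Set.Ioc 0 (n + 1 : ℝ))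
    (fun t => ENNReal.ofReal (2 * B n t)) with hg
  have mg : ∀ n, Measurable (g n) := fun n =>
    (ENNReal.measurable_ofReal.comp ((cB n).measurable.const_mul 2)).indicator measurableSet_Ioc
  have lim : ∀ t ∈ Set.Ioi (0:ℝ), ENNReal.ofReal (∫ x, k t x) =
      Filter.liminf (fun n => g n t) Filter.atTop := by
    intro t ht
    symm
    apply Filter.Tendsto.liminf_eq
    have h1 : Filter.Tendsto (fun n => ENNReal.ofReal (2 * B n t)) Filter.atTop
        (nhds (ENNReal.ofReal (∫ x, k t x))) := by
      apply ENNReal.tendsto_ofReal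
      rw [hfull]
      exact (intervalIntegral_tendsto_integral_Ioi 0 (hki t).integrableOn hatTop).const_mul 2
    refine h1.congr' ?_
    filter_upwards [hatTop.eventually_ge_atTop t] with n hn
    simp only [hg]
    rw [Set.indicator_of_mem (show t ∈ Set.Ioc 0 (n + 1 : ℝ) from ⟨ht, hn⟩)]
  rw [setLIntegral_congr (Ioi_ae_eq_Ici (a := (0:ℝ))).symm, 
    setLIntegral_congr_fun measurableSet_Ioi lim]
  refine (lintegral_liminf_le mg).trans ?_
  refine Filter.liminf_le_of_le (by isBoundedDefault) ?_
  intro c hc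
  obtain ⟨n, hn⟩ := hc.exists
  refine hn.trans ?_
  calc ∫⁻ t in Set.Ioi (0:ℝ), g n t ≤ ∫⁻ t, g n t := setLIntegral_le_lintegral _ _
    _ = ∫⁻ t in Set.Ioc 0 (n + 1 : ℝ), ENNReal.ofReal (2 * B n t) :=
      lintegral_indicator measurableSet_Ioc _
    _ = ENNReal.ofReal (∫ t in Set.Ioc 0 (n + 1 : ℝ), 2 * B n t) := by
      rw [ofReal_integral_eq_lintegral_ofReal]
      · exact (Continuous.integrableOn_Ioc (by fun_prop))
      · exact Filter.Eventually.of_forall fun t => by have := B0 n t; positivity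
    _ ≤ ENNReal.ofReal (2 * C) := by
      apply ENNReal.ofReal_le_ofReal
      rw [← intervalIntegral.integral_of_le (hn0 n), intervalIntegral.integral_const_mul]
      linarith [hb n]

lemma choose_eps {C q : ℝ} (hC : 0 < C) (hq : 0 < q) : ∃ ε > 0,
    2 * C * (8 / q) * (ε ^ 2) ^ q ≤ 1/8 ∧
    2 * C * (8 / q) * (8 * (q + 1) ^ 2 / q) * (ε ^ 2) ^ q ≤ 1/2 ∧ 32 * C * (ε ^ 2) ^ q ≤ 1 := by
  set A := 2 * C * (8 / q) with hA
  set B := 2 * C * (8 / q) * (8 * (q + 1) ^ 2 / q) with hB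
  have A0 : 0 < A := by positivity
  have B0 : 0 < B := by positivity
  set η := 1 / (8 * A + 2 * B + 32 * C) with hη
  have η0 : 0 < η := by positivity
  have h1 : (8 * A + 2 * B + 32 * C) * η = 1 := by rw [hη]; field_simp
  have pA := mul_pos A0 η0
  have pB := mul_pos B0 η0
  have pC := mul_pos hC η0
  refine ⟨Real.sqrt (η ^ (1 / q)), Real.sqrt_pos.2 (by positivity), ?_⟩
  have : (Real.sqrt (η ^ (1 / q)) ^ 2) ^ q = η := by
    rw [Real.sq_sqrt (by positivity), ← rpow_mul η0.le, one_div_mul_cancel hq.ne', rpow_one]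
  rw [this]
  refine ⟨?_, ?_, ?_⟩ <;> nlinarith

end NLSaux

open MeasureTheory Real

/-- Proposition 3.6: time-integrability of the weighted H¹ norm for small odd
solutions of NLS with potential. -/
theorem time_integrability_NLS_potential
    (p C₀ : ℝ) (hp1 : 1 < p) (hp5 : p < 5)
    (f : ℝ → ℝ) (hf : ∀ s : ℝ, 0 ≤ s → |f s| ≤ C₀ * s ^ ((p - 1) / 2))
    (V : SchwartzMap ℝ ℝ) (hV0 : (V : ℝ → ℝ) ≠ 0)
    (hVeven : ∀ x : ℝ, V (-x) = V x)
    (hVint : Integrable (fun x : ℝ => (|V x| + |deriv (V : ℝ → ℝ) x|) * Real.cosh (2 * x))) :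
    ∃ μ₀ > 0, ∃ ε > 0, ∃ C > 0, ∀ μ : ℝ, μ ∈ Set.Ioo 0 μ₀ → ∀ u : ℝ → ℝ → ℂ,
      ContDiff ℝ (⊤ : ℕ∞) (Function.uncurry u) →
      (∀ t x : ℝ, Complex.I * deriv (fun s => u s x) t + deriv (deriv (u t)) x
          = ((μ * V x : ℝ) : ℂ) * u t x + (f (‖u t x‖ ^ 2) : ℂ) * u t x) →
      (∀ t x : ℝ, u t (-x) = - u t x) →
      (∀ t : ℝ, ∃ g : SchwartzMap ℝ ℂ, ∀ x : ℝ, u t x = g x) →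
      (∀ t : ℝ, (∫ x : ℝ, ‖u t x‖ ^ 2) + (∫ x : ℝ, ‖deriv (u t) x‖ ^ 2) ≤ ε ^ 2) →
      ∫⁻ t in Set.Ici (0 : ℝ),
        ENNReal.ofReal (∫ x : ℝ, (1 / Real.cosh x) * (‖deriv (u t) x‖ ^ 2 + ‖u t x‖ ^ 2))
      ≤ ENNReal.ofReal (C * ε ^ 2) := by
  -- constants
  set q := (p - 1) / 2 with hq
  have hq0 : 0 < q := by rw [hq]; linarith
  set C₁ := |C₀| + 1 with hC₁
  have hC₁0 : 0 < C₁ := by positivity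
  have hf' : ∀ s : ℝ, 0 ≤ s → |f s| ≤ C₁ * s ^ q := fun s hs => (hf s hs).trans (by
    gcongr
    linarith [le_abs_self C₀])
  have cV1 : Continuous (deriv (V : ℝ → ℝ)) := (V.smooth 1).continuous_deriv le_rfl
  set CV := 2 * ∫ x : ℝ, (|V x| + |deriv (V : ℝ → ℝ) x|) * Real.cosh (2 * x) with hCV
  have hpos : ∀ x : ℝ, 0 ≤ (|V x| + |deriv (V : ℝ → ℝ) x|) * Real.cosh (2 * x) := fun x =>
    mul_nonneg (by positivity) (Real.cosh_pos _).le
  have hCV0 : 0 ≤ CV := mul_nonneg (by norm_num) (integral_nonneg hpos)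
  have hCVb : ∀ R, 0 ≤ R → ∫ x in (0:ℝ)..R, |deriv (V : ℝ → ℝ) x| * exp (1/2 * x) ≤ CV := by
    intro R hR
    calc ∫ x in (0:ℝ)..R, |deriv (V : ℝ → ℝ) x| * exp (1/2 * x)
        ≤ ∫ x in (0:ℝ)..R, 2 * ((|V x| + |deriv (V : ℝ → ℝ) x|) * Real.cosh (2 * x)) := by
          apply intervalIntegral.integral_mono_on hR
            (Continuous.intervalIntegrable (by fun_prop) _ _)
            ((hVint.const_mul 2).intervalIntegrable)
          intro x hx
          have h1 : exp (1/2 * x) ≤ exp (2 * x) := exp_le_exp.2 (by linarith [hx.1])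
          have h2 : exp (2 * x) ≤ 2 * Real.cosh (2 * x) := by
            rw [Real.cosh_eq]; linarith [exp_pos (-(2 * x))]
          have h3 := Real.cosh_pos (2 * x)
          calc |deriv (V : ℝ → ℝ) x| * exp (1/2 * x)
              ≤ (|V x| + |deriv (V : ℝ → ℝ) x|) * (2 * Real.cosh (2 * x)) := by
                gcongr
                · linarith [abs_nonneg (V x)]
                · linarith
            _ = _ := by ring
      _ ≤ CV := by
          rw [intervalIntegral.integral_const_mul, intervalIntegral.integral_of_le hR, hCV]
          exact mul_le_mul_of_nonneg_left
            (setIntegral_le_integral hVint (Filter.Eventually.of_forall hpos)) (by norm_num)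
  obtain ⟨ε, hε, k2, k3, k4⟩ := NLSaux.choose_eps hC₁0 hq0
  refine ⟨1 / (32 * (CV + 1)), by positivity, ε, hε, 1980, by norm_num, ?_⟩
  intro μ hμ u hu hpde hodd hsch hE
  have k1 : 16 * μ * CV ≤ 1/2 := by
    have h := hμ.2
    rw [lt_div_iff₀ (by positivity)] at h
    nlinarith [hμ.1]
  set U := Function.uncurry u with hU
  have hUx := NLSaux.Dx_smooth hu
  have ha : ContDiff ℝ (⊤ : ℕ∞) (fun p => Complex.reCLM (U p)) := Complex.reCLM.contDiff.comp hu
  have hb : ContDiff ℝ (⊤ : ℕ∞) (fun p => Complex.imCLM (U p)) := Complex.imCLM.contDiff.comp hu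
  set a : ℝ × ℝ → ℝ := fun p => Complex.reCLM (U p) with hadef
  set b : ℝ × ℝ → ℝ := fun p => Complex.imCLM (U p) with hbdef
  have dux : ∀ t, deriv (u t) = fun x => NLSaux.Dx U (t, x) := fun t =>
    funext fun x => (NLSaux.Dx_has hu t x).deriv
  have duxx : ∀ t x, deriv (deriv (u t)) x = NLSaux.Dx (NLSaux.Dx U) (t, x) := fun t x => by
    rw [dux]; exact (NLSaux.Dx_has hUx t x).deriv
  have dut : ∀ t x, deriv (fun s => u s x) t = NLSaux.Dt U (t, x) := fun t x =>
    (NLSaux.Dt_has hu t x).deriv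
  have hax : NLSaux.Dx a = fun p => Complex.reCLM (NLSaux.Dx U p) := (NLSaux.DL _ hu).1
  have hbx : NLSaux.Dx b = fun p => Complex.imCLM (NLSaux.Dx U p) := (NLSaux.DL _ hu).1
  have hat : NLSaux.Dt a = fun p => Complex.reCLM (NLSaux.Dt U p) := (NLSaux.DL _ hu).2
  have hbt : NLSaux.Dt b = fun p => Complex.imCLM (NLSaux.Dt U p) := (NLSaux.DL _ hu).2
  have haxx : NLSaux.Dx (NLSaux.Dx a) = fun p => Complex.reCLM (NLSaux.Dx (NLSaux.Dx U) p) := by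
    rw [hax]; exact (NLSaux.DL _ hUx).1
  have hbxx : NLSaux.Dx (NLSaux.Dx b) = fun p => Complex.imCLM (NLSaux.Dx (NLSaux.Dx U) p) := by
    rw [hbx]; exact (NLSaux.DL _ hUx).1
  have nu : ∀ t x, ‖u t x‖ ^ 2 = a (t, x) ^ 2 + b (t, x) ^ 2 := fun t x => by
    rw [Complex.sq_norm, Complex.normSq_apply]
    simp [a, b, U, Function.uncurry]; ring
  have nux : ∀ t x, ‖deriv (u t) x‖ ^ 2 = NLSaux.Dx a (t, x) ^ 2 + NLSaux.Dx b (t, x) ^ 2 :=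
    fun t x => by
      rw [dux, hax, hbx, Complex.sq_norm, Complex.normSq_apply]
      simp; ring
  have e1 : ∀ t x, - NLSaux.Dt b (t, x) + NLSaux.Dx (NLSaux.Dx a) (t, x) =
      (μ * V x + f (a (t, x) ^ 2 + b (t, x) ^ 2)) * a (t, x) := by
    intro t x
    have h := congrArg Complex.re (hpde t x)
    rw [dut, duxx, nu] at h
    rw [hbt, haxx]
    simp only [Complex.add_re, Complex.mul_re, Complex.I_re, Complex.I_im, Complex.ofReal_re,
      Complex.ofReal_im] at h
    simp only [a, b, U, Function.uncurry, Complex.reCLM_apply, Complex.imCLM_apply] at h ⊢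
    linarith
  have e2 : ∀ t x, NLSaux.Dt a (t, x) + NLSaux.Dx (NLSaux.Dx b) (t, x) =
      (μ * V x + f (a (t, x) ^ 2 + b (t, x) ^ 2)) * b (t, x) := by
    intro t x
    have h := congrArg Complex.im (hpde t x)
    rw [dut, duxx, nu] at h
    rw [hat, hbxx]
    simp only [Complex.add_im, Complex.mul_im, Complex.I_re, Complex.I_im, Complex.ofReal_re,
      Complex.ofReal_im] at h
    simp only [a, b, U, Function.uncurry, Complex.reCLM_apply, Complex.imCLM_apply] at h ⊢
    linarith
  have u0 : ∀ t, u t 0 = 0 := fun t => by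
    have h := hodd t 0
    rw [neg_zero] at h
    exact self_eq_neg.1 h
  have a0 : ∀ t, a (t, 0) = 0 := fun t => by simp [a, U, Function.uncurry, u0]
  have b0 : ∀ t, b (t, 0) = 0 := fun t => by simp [b, U, Function.uncurry, u0]
  -- integrability
  have i1 : ∀ t, Integrable (fun x => ‖u t x‖ ^ 2) := by
    intro t
    obtain ⟨g, hg⟩ := hsch t
    simp only [hg]
    exact (g.memLp 2).integrable_norm_pow (by norm_num)
  have i2 : ∀ t, Integrable (fun x => ‖deriv (u t) x‖ ^ 2) := by
    intro t
    obtain ⟨g, hg⟩ := hsch t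
    have : u t = g := funext hg
    rw [this]
    exact ((SchwartzMap.derivCLM ℝ ℂ g).memLp 2).integrable_norm_pow (by norm_num)
  have ca := ha.continuous
  have cb := hb.continuous
  have ca1 := (NLSaux.Dx_smooth ha).continuous
  have cb1 := (NLSaux.Dx_smooth hb).continuous
  have hEb : ∀ t R, 0 ≤ R → ∫ x in (0:ℝ)..R, (NLSaux.Dx a (t, x) ^ 2 + NLSaux.Dx b (t, x) ^ 2 +
      (a (t, x) ^ 2 + b (t, x) ^ 2)) ≤ ε ^ 2 := by
    intro t R hR
    simp only [← nu, ← nux]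
    rw [intervalIntegral.integral_of_le hR]
    refine (setIntegral_le_integral ((i2 t).add (i1 t))
      (Filter.Eventually.of_forall fun x => by simp only [Pi.add_apply, Pi.zero_apply]; positivity)).trans ?_
    have := hE t
    have h2 := integral_add (i2 t) (i1 t)
    simp only [Pi.add_apply] 
    linarith
  -- conclusion
  have ksl : ∀ n : ℕ, ∫ t in (0:ℝ)..(n + 1 : ℝ), ∫ x in (0:ℝ)..(n + 1 : ℝ),
      (1 / Real.cosh x) * (‖deriv (u t) x‖ ^ 2 + ‖u t x‖ ^ 2) ≤ 990 * ε ^ 2 := by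
    intro n
    have hn : (1:ℝ) ≤ n + 1 := by linarith [Nat.cast_nonneg (α := ℝ) n]
    have hs := NLSaux.slab hp1 hC₁0.le hf' V hCVb ha hb hq hμ.1.le rfl e1 e2 a0 b0 hEb k1 k2 k3 k4
      hn (by linarith : (0:ℝ) ≤ n + 1)
    have h1 : ∫ t in (0:ℝ)..(n + 1 : ℝ), ∫ x in (0:ℝ)..(n + 1 : ℝ),
      (1 / Real.cosh x) * (‖deriv (u t) x‖ ^ 2 + ‖u t x‖ ^ 2) ≤
      ∫ t in (0:ℝ)..(n + 1 : ℝ), 2 * ∫ x in (0:ℝ)..(n + 1 : ℝ), exp (-x) *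
       (NLSaux.Dx a (t, x) ^ 2 + NLSaux.Dx b (t, x) ^ 2 + (a (t, x) ^ 2 + b (t, x) ^ 2)) := by
      simp only [nu, nux]
      have cc : Continuous (fun x : ℝ => 1 / Real.cosh x) :=
        continuous_const.div Real.continuous_cosh fun x => (Real.cosh_pos x).ne'
      apply intervalIntegral.integral_mono_on (by linarith)
      · apply Continuous.intervalIntegrable
        apply intervalIntegral.continuous_parametric_intervalIntegral_of_continuous'
        unfold Function.uncurry; first | fun_prop | exact Continuous.mul (cc.comp continuous_snd) (by fun_prop)
      · apply Continuous.intervalIntegrable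
        apply Continuous.mul continuous_const
        apply intervalIntegral.continuous_parametric_intervalIntegral_of_continuous'
        unfold Function.uncurry; first | fun_prop | exact Continuous.mul (cc.comp continuous_snd) (by fun_prop)
      · intro t _
        rw [← intervalIntegral.integral_const_mul]
        apply intervalIntegral.integral_mono_on (by linarith)
          (Continuous.intervalIntegrable (by fun_prop) _ _)
          (Continuous.intervalIntegrable (by fun_prop) _ _)
        intro x _
        rw [← mul_assoc]
        gcongr
        rw [div_le_iff₀ (Real.cosh_pos x), Real.cosh_eq]
        have h2 : exp (-x) * exp x = 1 := by rw [← exp_add]; simp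
        nlinarith [exp_pos (-x)]
    rw [intervalIntegral.integral_const_mul] at h1
    have h2 : 41 * ε ^ 2 / ((n:ℝ) + 1) * (n + 1) = 41 * ε ^ 2 := by field_simp
    rw [h2] at hs
    linarith
  have hfin := NLSaux.fatou_step
    (k := fun t x => (1 / Real.cosh x) * (‖deriv (u t) x‖ ^ 2 + ‖u t x‖ ^ 2))
    (by
      have cc : Continuous (fun x : ℝ => 1 / Real.cosh x) :=
        continuous_const.div Real.continuous_cosh fun x => (Real.cosh_pos x).ne'
      simp only [nu, nux]
      unfold Function.uncurry; first | fun_prop | exact Continuous.mul (cc.comp continuous_snd) (by fun_prop))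
    (fun t x => mul_nonneg (one_div_nonneg.2 (Real.cosh_pos x).le) (by positivity))
    (by
      intro t
      have cc : Continuous (fun x : ℝ => 1 / Real.cosh x) :=
        continuous_const.div Real.continuous_cosh fun x => (Real.cosh_pos x).ne'
      refine ((i2 t).add (i1 t)).bdd_mul (c := 1) cc.aestronglyMeasurable
        (Filter.Eventually.of_forall fun x => ?_)
      rw [norm_of_nonneg (one_div_nonneg.2 (Real.cosh_pos x).le), div_le_one (Real.cosh_pos x)]
      exact Real.one_le_cosh x)
    (by
      intro t x
      have h1 : ‖u t (-x)‖ = ‖u t x‖ := by rw [hodd, norm_neg]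
      have h2 : ‖deriv (u t) (-x)‖ = ‖deriv (u t) x‖ := by
        have h3 : (fun y => u t (-y)) = fun y => - u t y := funext (hodd t)
        have h4 := congrArg (fun F => deriv F x) h3
        simp only [deriv_comp_neg, deriv.fun_neg, neg_inj] at h4
        rw [h4]
      simp only [h1, h2, Real.cosh_neg])
    ksl
  refine hfin.trans (le_of_eq ?_)
  congr 1; ring
end

section
/- Let 0 < a < 1. There exists C > 0 such that: if u is a smooth solution of the defocusing Hartree equation i∂ₜu + ∂ₓₓu = (|x|^{-a} ∗ |u|²)u, odd in x, with u(t,·) in the Schwartz class in x for each t and ‖u(0,·)‖_{L²(ℝ)}² + ‖∂ₓu(0,·)‖_{L²(ℝ)}² ≤ ε² for some ε > 0 (with the same bound propagated for all t, sup_{t∈ℝ}(‖u(t,·)‖_{L²(ℝ)}² + ‖∂ₓu(t,·)‖_{L²(ℝ)}²) ≤ ε²), then ∫₀^∞ ∫_ℝ sech(x)(|∂ₓu(t,x)|² + |u(t,x)|²) dx dt ≤ C·ε². -/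
open MeasureTheory Real

lemma aux_kernel (a : ℝ) (_ha0 : 0 < a) (ha1 : a < 1) :
    ∃ K0 : ℝ, 0 ≤ K0 ∧ ∀ (ρ : ℝ → ℝ) (M : ℝ), Continuous ρ → (∀ x, 0 ≤ ρ x) → (∀ x, ρ x ≤ M) →
      Integrable ρ → ∀ x : ℝ, Integrable (fun y => |x - y| ^ (-a) * ρ y) ∧
        ∫ y, |x - y| ^ (-a) * ρ y ≤ M * K0 + ∫ y, ρ y := by
  classical
  set f : ℝ → ℝ := (Set.Iic (1:ℝ)).indicator (fun z => z ^ (-a)) with hf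
  have hf0 : ∀ z, 0 ≤ z → 0 ≤ f z := by
    intro z hz
    simp only [hf, Set.indicator]
    split_ifs
    · positivity
    · exact le_rfl
  have hfi : IntegrableOn f (Set.Ioi 0) := by
    rw [hf, integrableOn_indicator_iff measurableSet_Iic]
    have := (intervalIntegral.intervalIntegrable_rpow' (a := 0) (b := 1) (r := -a) (by linarith))
    rw [intervalIntegrable_iff_integrableOn_Ioc_of_le zero_le_one] at this
    refine this.mono_set ?_
    intro z hz
    exact ⟨hz.2, hz.1⟩
  have hκ : Integrable (fun z : ℝ => f |z|) := by
    have h1 : IntegrableOn (fun z : ℝ => f |z|) (Set.Ioi 0) :=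
      hfi.congr_fun (fun z hz => by simp only [abs_of_pos (Set.mem_Ioi.1 hz)]) measurableSet_Ioi
    have h2 : IntegrableOn (fun z : ℝ => f |z|) (Set.Iio 0) := by
      have h3 : IntegrableOn (fun z : ℝ => f |z|) (Set.Ioi (-0)) := by simpa using h1
      have := h3.comp_neg_Iio
      simpa using this
    rw [← integrableOn_univ, ← Set.Iic_union_Ioi (a := (0:ℝ))]
    exact ((integrableOn_Iic_iff_integrableOn_Iio (by simp)).2 h2).union h1
  refine ⟨∫ z : ℝ, f |z|, integral_nonneg fun z => hf0 _ (abs_nonneg z), ?_⟩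
  intro ρ M hc h0 hM hi x
  have hdom : Integrable (fun y => M * f |x - y| + ρ y) :=
    ((hκ.comp_sub_left x).const_mul M).add hi
  have hle : ∀ y, |x - y| ^ (-a) * ρ y ≤ M * f |x - y| + ρ y := by
    intro y
    by_cases h : |x - y| ≤ 1
    · have : f |x - y| = |x - y| ^ (-a) := by simp [hf, h]
      rw [this]
      have h1 : 0 ≤ |x - y| ^ (-a) := by positivity
      nlinarith [h0 y, hM y]
    · have : f |x - y| = 0 := by simp only [hf, Set.indicator]; rw [if_neg]; simpa using h
      rw [this]
      have h1 : |x - y| ^ (-a) ≤ 1 := by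
        apply Real.rpow_le_one_of_one_le_of_nonpos <;> linarith
      nlinarith [h0 y]
  have hint : Integrable (fun y => |x - y| ^ (-a) * ρ y) := by
    refine hdom.mono' ?_ (Filter.Eventually.of_forall fun y => ?_)
    · apply Measurable.aestronglyMeasurable
      have := hc.measurable
      fun_prop
    · rw [Real.norm_of_nonneg (mul_nonneg (by positivity) (h0 y))]
      exact hle y
  refine ⟨hint, (integral_mono hint hdom hle).trans ?_⟩
  rw [integral_add ((hκ.comp_sub_left x).const_mul M) hi, integral_const_mul,
    integral_sub_left_eq_self (fun z : ℝ => f |z|)]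

/-- regularised kernel -/
noncomputable def aux_k (a η z : ℝ) : ℝ := (z ^ 2 + η) ^ (-a / 2)
/-- minus its derivative -/
noncomputable def aux_k' (a η z : ℝ) : ℝ := a * z * (z ^ 2 + η) ^ (-a / 2 - 1)

lemma aux_k_deriv (a η z : ℝ) (hη : 0 < η) : HasDerivAt (aux_k a η) (- aux_k' a η z) z := by
  have h1 : HasDerivAt (fun z : ℝ => z ^ 2 + η) (2 * z) z := by
    simpa using (hasDerivAt_pow 2 z).add_const η
  have := h1.rpow_const (p := -a / 2) (Or.inl (by positivity))
  have e : - aux_k' a η z = 2 * z * (-a / 2) * (z ^ 2 + η) ^ (-a / 2 - 1) := by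
    unfold aux_k'; ring
  rw [e]
  exact this

lemma aux_k_cont (a η : ℝ) (hη : 0 < η) : Continuous (aux_k a η) := by
  unfold aux_k
  apply Continuous.rpow_const (by fun_prop)
  intro z; left; positivity

lemma aux_k'_cont (a η : ℝ) (hη : 0 < η) : Continuous (aux_k' a η) := by
  unfold aux_k'
  apply Continuous.mul (by fun_prop)
  apply Continuous.rpow_const (by fun_prop)
  intro z; left; positivity

lemma aux_k_nonneg (a η z : ℝ) (hη : 0 < η) : 0 ≤ aux_k a η z := by
  unfold aux_k; positivity

lemma aux_k_le (a η z : ℝ) (ha : 0 < a) (hη : 0 < η) : aux_k a η z ≤ η ^ (-a / 2) := by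
  unfold aux_k
  apply Real.rpow_le_rpow_of_nonpos hη (by nlinarith [sq_nonneg z]) (by linarith)

lemma aux_k_le' (a η z : ℝ) (ha : 0 < a) (hη : 0 < η) (hz : z ≠ 0) : aux_k a η z ≤ |z| ^ (-a) := by
  have h : |z| ^ (-a) = (z ^ 2) ^ (-a / 2) := by
    rw [← sq_abs, ← Real.rpow_natCast, ← Real.rpow_mul (abs_nonneg z)]; congr 1; push_cast; ring
  rw [h]
  unfold aux_k
  apply Real.rpow_le_rpow_of_nonpos (by positivity) (by linarith) (by linarith)

lemma aux_zk' (a η z : ℝ) (ha : 0 < a) (hη : 0 < η) :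
    0 ≤ z * aux_k' a η z ∧ z * aux_k' a η z ≤ a * aux_k a η z := by
  unfold aux_k' aux_k
  have hp : 0 < z ^ 2 + η := by positivity
  have h : (z ^ 2 + η) ^ (-a / 2) = (z ^ 2 + η) * (z ^ 2 + η) ^ (-a / 2 - 1) := by
    rw [Real.rpow_sub_one hp.ne']; field_simp
  have h2 : 0 ≤ (z ^ 2 + η) ^ (-a / 2 - 1) := by positivity
  rw [h]
  constructor
  · have : 0 ≤ a * z ^ 2 * (z ^ 2 + η) ^ (-a / 2 - 1) := by positivity
    nlinarith
  · have : 0 ≤ a * η * (z ^ 2 + η) ^ (-a / 2 - 1) := by positivity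
    nlinarith

lemma aux_k'_bdd (a η z : ℝ) (ha : 0 < a) (hη : 0 < η) :
    |aux_k' a η z| ≤ a * η ^ (-a / 2) + a * η ^ (-a / 2 - 1) := by
  have hA : 0 ≤ a * η ^ (-a / 2) := by positivity
  have hB : 0 ≤ a * η ^ (-a / 2 - 1) := by positivity
  rcases le_total |z| 1 with h | h
  · have h1 : |aux_k' a η z| ≤ a * η ^ (-a / 2 - 1) := by
      unfold aux_k'
      rw [abs_mul, abs_mul, abs_of_pos ha, abs_of_nonneg (by positivity : 0 ≤ (z ^ 2 + η) ^ (-a / 2 - 1))]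
      have : (z ^ 2 + η) ^ (-a / 2 - 1) ≤ η ^ (-a / 2 - 1) := by
        apply Real.rpow_le_rpow_of_nonpos hη (by nlinarith [sq_nonneg z]) (by linarith)
      have h3 : a * |z| ≤ a := by nlinarith
      exact mul_le_mul h3 this (by positivity) ha.le
    linarith
  · have h1 : |aux_k' a η z| ≤ a * η ^ (-a / 2) := by
      have h2 := aux_zk' a η z ha hη
      have h3 : |z| * |aux_k' a η z| = z * aux_k' a η z := by
        rw [← abs_mul, abs_of_nonneg h2.1]
      have h4 := aux_k_le a η z ha hη
      have : |aux_k' a η z| ≤ |z| * |aux_k' a η z| := le_mul_of_one_le_left (abs_nonneg _) h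
      nlinarith
    linarith

lemma aux_k_tendsto (a z : ℝ) (hz : z ≠ 0) :
    Filter.Tendsto (fun η => aux_k a η z) (nhdsWithin 0 (Set.Ioi 0)) (nhds (|z| ^ (-a))) := by
  have h : |z| ^ (-a) = (z ^ 2 + 0) ^ (-a / 2) := by
    rw [add_zero, ← sq_abs, ← Real.rpow_natCast, ← Real.rpow_mul (abs_nonneg z)]; congr 1; push_cast; ring
  rw [h]
  have : ContinuousAt (fun η : ℝ => (z ^ 2 + η) ^ (-a / 2)) 0 := by
    apply ContinuousAt.rpow_const (by fun_prop)
    left; simpa using hz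
  exact this.tendsto.mono_left nhdsWithin_le_nhds

lemma aux_prod_int (κ F G : ℝ → ℝ) (c : ℝ) (hκ : Continuous κ) (hc : ∀ z, |κ z| ≤ c)
    (hF : Integrable F) (hG : Integrable G) :
    Integrable (fun p : ℝ × ℝ => κ (p.1 - p.2) * (F p.1 * G p.2)) (volume.prod volume) := by
  refine (hF.mul_prod hG).bdd_mul (c := c) ?_ (Filter.Eventually.of_forall fun p => hc _)
  exact (hκ.comp (by fun_prop)).aestronglyMeasurable

lemma aux_nonlin_reg (a η L B : ℝ) (ha : 0 < a) (hη : 0 < η) (hL : 0 ≤ L)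
    (ρ ρ' ψ ψ' : ℝ → ℝ) (hρ : ∀ x, HasDerivAt ρ (ρ' x) x) (hρ' : Continuous ρ')
    (hψ : ∀ x, HasDerivAt ψ (ψ' x) x) (hψ' : Continuous ψ')
    (hs : HasCompactSupport ψ) (hs' : HasCompactSupport ψ') (h0 : ∀ x, 0 ≤ ρ x)
    (hi : Integrable ρ) (hLψ : ∀ x, -L ≤ ψ' x) (hB : ∀ x, ∫ y, aux_k a η (x - y) * ρ y ≤ B) :
    -(a * L / 2 * B * ∫ y, ρ y) ≤
      ∫ x, (∫ y, aux_k a η (x - y) * ρ y) * (ψ' x * ρ x + ψ x * ρ' x) := by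
  have hρc : Continuous ρ := continuous_iff_continuousAt.2 fun x => (hρ x).continuousAt
  have hψc : Continuous ψ := continuous_iff_continuousAt.2 fun x => (hψ x).continuousAt
  have hkc := aux_k_cont a η hη
  have hk'c := aux_k'_cont a η hη
  have hkb : ∀ z, |aux_k a η z| ≤ η ^ (-a / 2) := fun z => by
    rw [abs_of_nonneg (aux_k_nonneg a η z hη)]; exact aux_k_le a η z ha hη
  have hk'b := fun z => aux_k'_bdd a η z ha hη
  set f : ℝ → ℝ := fun x => ψ' x * ρ x + ψ x * ρ' x with hf
  set g : ℝ → ℝ := fun x => ψ x * ρ x with hg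
  have hgd : ∀ x, HasDerivAt g (f x) x := fun x => (hψ x).mul (hρ x)
  have hfi : Integrable f := by
    apply Continuous.integrable_of_hasCompactSupport (by fun_prop)
    exact (hs'.mul_right).add (hs.mul_right)
  have hgi : Integrable g := by
    apply Continuous.integrable_of_hasCompactSupport (by fun_prop)
    exact hs.mul_right
  have step1 : ∫ x, (∫ y, aux_k a η (x - y) * ρ y) * f x
      = ∫ x, ∫ y, aux_k a η (x - y) * (f x * ρ y) := by
    congr 1; ext x
    rw [← integral_mul_const]
    congr 1; ext y; ring
  have step2 : ∫ x, ∫ y, aux_k a η (x - y) * (f x * ρ y)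
      = ∫ y, ∫ x, aux_k a η (x - y) * (f x * ρ y) :=
    integral_integral_swap (f := fun x y => aux_k a η (x - y) * (f x * ρ y))
      (aux_prod_int _ f ρ _ hkc hkb hfi hi)
  have step3 : ∀ y, ∫ x, aux_k a η (x - y) * (f x * ρ y)
      = ∫ x, aux_k' a η (x - y) * (g x * ρ y) := by
    intro y
    have hkd : ∀ x, HasDerivAt (fun x => aux_k a η (x - y)) (- aux_k' a η (x - y)) x := by
      intro x
      have := (aux_k_deriv a η (x - y) hη).comp_sub_const x y
      exact this
    have h1 : Integrable (fun x => aux_k a η (x - y) * f x) :=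
      hfi.bdd_mul (hkc.comp (by fun_prop)).aestronglyMeasurable
        (Filter.Eventually.of_forall fun x => hkb _)
    have h2 : Integrable (fun x => aux_k a η (x - y) * g x) :=
      hgi.bdd_mul (hkc.comp (by fun_prop)).aestronglyMeasurable
        (Filter.Eventually.of_forall fun x => hkb _)
    have h3 : Integrable (fun x => aux_k' a η (x - y) * g x) :=
      hgi.bdd_mul (hk'c.comp (by fun_prop)).aestronglyMeasurable
        (Filter.Eventually.of_forall fun x => hk'b _)
    have h4 : Integrable (fun x => - aux_k' a η (x - y) * g x) := by
      simpa [neg_mul] using h3.neg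
    have := integral_mul_deriv_eq_deriv_mul_of_integrable (fun x _ => hkd x) (fun x _ => hgd x)
      h1 h4 h2
    simp_rw [← mul_assoc]
    rw [integral_mul_const, integral_mul_const, this, ← integral_neg]
    congr 2; ext x; ring
  set T : ℝ × ℝ → ℝ := fun p => aux_k' a η (p.1 - p.2) * (g p.1 * ρ p.2) with hT
  have hTi : Integrable T (volume.prod volume) := aux_prod_int _ g ρ _ hk'c hk'b hgi hi
  have step4 : ∫ x, (∫ y, aux_k a η (x - y) * ρ y) * f x = ∫ p, T p ∂(volume.prod volume) := by
    rw [step1, step2, integral_prod_symm T hTi]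
    congr 1; ext y; exact step3 y
  have hQi : Integrable (fun p : ℝ × ℝ => aux_k a η (p.1 - p.2) * (ρ p.1 * ρ p.2))
    (volume.prod volume) := aux_prod_int _ ρ ρ _ hkc hkb hi hi
  have mono : Monotone (fun x => ψ x + L * x) := by
    have hd : ∀ x, HasDerivAt (fun x => ψ x + L * x) (ψ' x + L) x := fun x => by
      have := (hψ x).fun_add ((hasDerivAt_id' x).const_mul L)
      rwa [mul_one] at this
    apply monotone_of_deriv_nonneg (fun x => (hd x).differentiableAt)
    intro x; rw [(hd x).deriv]; linarith [hLψ x]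
  have hpt : ∀ x y, -(L * a) * aux_k a η (x - y) ≤ aux_k' a η (x - y) * (ψ x - ψ y) := by
    intro x y
    obtain ⟨c, hc, hce⟩ : ∃ c, 0 ≤ c ∧ aux_k' a η (x - y) = c * (x - y) :=
      ⟨a * ((x - y) ^ 2 + η) ^ (-a / 2 - 1), by positivity, by unfold aux_k'; ring⟩
    have h1 : -L * (x - y) ^ 2 ≤ (x - y) * (ψ x - ψ y) := by
      rcases le_total x y with h | h
      · have := mono h; simp only at this; nlinarith
      · have := mono h; simp only at this; nlinarith
    have h2 := (aux_zk' a η (x - y) ha hη).2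
    rw [hce] at h2 ⊢
    have h3 := mul_le_mul_of_nonneg_left h1 hc
    have h4 := mul_le_mul_of_nonneg_left h2 hL
    nlinarith
  have hsym : ∫ p, T p.swap ∂(volume.prod volume) = ∫ p, T p ∂(volume.prod volume) :=
    integral_prod_swap T
  have hsum : ∫ p, (-(L * a)) * (aux_k a η (p.1 - p.2) * (ρ p.1 * ρ p.2)) ∂(volume.prod volume)
      ≤ ∫ p, (T p + T p.swap) ∂(volume.prod volume) := by
    apply integral_mono (hQi.const_mul _) (hTi.add hTi.swap)
    intro p
    have h1 := hpt p.1 p.2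
    have h2 : aux_k' a η (p.2 - p.1) = - aux_k' a η (p.1 - p.2) := by
      unfold aux_k'
      rw [show (p.2 - p.1) ^ 2 = (p.1 - p.2) ^ 2 by ring]; ring
    have h3 := mul_le_mul_of_nonneg_right h1 (mul_nonneg (h0 p.1) (h0 p.2))
    change _ ≤ aux_k' a η (p.1 - p.2) * (ψ p.1 * ρ p.1 * ρ p.2)
      + aux_k' a η (p.2 - p.1) * (ψ p.2 * ρ p.2 * ρ p.1)
    rw [h2]
    nlinarith
  have hQ : ∫ p, aux_k a η (p.1 - p.2) * (ρ p.1 * ρ p.2) ∂(volume.prod volume) ≤ B * ∫ y, ρ y := by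
    rw [integral_prod _ hQi, ← integral_const_mul]
    apply integral_mono hQi.integral_prod_left (hi.const_mul B)
    intro x
    have := mul_le_mul_of_nonneg_right (hB x) (h0 x)
    rw [← integral_mul_const] at this
    refine le_trans (le_of_eq ?_) this
    simp only
    congr 1; ext y; ring
  have hTs : Integrable (fun p : ℝ × ℝ => T p.swap) (volume.prod volume) := hTi.swap
  rw [integral_const_mul, integral_add hTi hTs, hsym] at hsum
  rw [step4]
  have := mul_le_mul_of_nonneg_left hQ (mul_nonneg hL ha.le)
  nlinarith

lemma aux_nonlin (a : ℝ) (ha0 : 0 < a) (ha1 : a < 1) :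
    ∃ K0 : ℝ, 0 ≤ K0 ∧ ∀ (L M : ℝ) (_hL : 0 ≤ L)
    (ρ ρ' ψ ψ' : ℝ → ℝ) (_hρ : ∀ x, HasDerivAt ρ (ρ' x) x) (_hρ' : Continuous ρ')
    (_hψ : ∀ x, HasDerivAt ψ (ψ' x) x) (_hψ' : Continuous ψ')
    (_hs : HasCompactSupport ψ) (_hs' : HasCompactSupport ψ') (_h0 : ∀ x, 0 ≤ ρ x)
    (_hM : ∀ x, ρ x ≤ M)
    (_hi : Integrable ρ) (_hLψ : ∀ x, -L ≤ ψ' x),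
    -(a * L / 2 * (M * K0 + ∫ y, ρ y) * ∫ y, ρ y) ≤
      ∫ x, (∫ y, |x - y| ^ (-a) * ρ y) * (ψ' x * ρ x + ψ x * ρ' x) := by
  obtain ⟨K0, hK0, hK⟩ := aux_kernel a ha0 ha1
  refine ⟨K0, hK0, ?_⟩
  intro L M hL ρ ρ' ψ ψ' hρ hρ' hψ hψ' hs hs' h0 hM hi hLψ
  have hρc : Continuous ρ := continuous_iff_continuousAt.2 fun x => (hρ x).continuousAt
  have hψc : Continuous ψ := continuous_iff_continuousAt.2 fun x => (hψ x).continuousAt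
  have hV := hK ρ M hρc h0 hM hi
  have hfi : Integrable (fun x => ψ' x * ρ x + ψ x * ρ' x) := by
    apply Continuous.integrable_of_hasCompactSupport (by fun_prop)
    exact (hs'.mul_right).add (hs.mul_right)
  have hne : ∀ x : ℝ, ∀ᵐ y : ℝ, x - y ≠ 0 := by
    intro x
    filter_upwards [Measure.ae_ne volume x] with y hy
    exact sub_ne_zero.2 (Ne.symm hy)
  have hle : ∀ η, 0 < η → ∀ x, ∀ᵐ y : ℝ, aux_k a η (x - y) * ρ y ≤ |x - y| ^ (-a) * ρ y := by
    intro η hη x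
    filter_upwards [hne x] with y hy
    exact mul_le_mul_of_nonneg_right (aux_k_le' a η _ ha0 hη hy) (h0 y)
  have hki : ∀ η, 0 < η → ∀ x, Integrable (fun y => aux_k a η (x - y) * ρ y) := by
    intro η hη x
    refine (hV x).1.mono' (((aux_k_cont a η hη).comp (by fun_prop)).mul hρc).aestronglyMeasurable ?_
    filter_upwards [hle η hη x] with y hy
    rwa [Real.norm_of_nonneg (mul_nonneg (aux_k_nonneg _ _ _ hη) (h0 y))]
  have hB : ∀ η, 0 < η → ∀ x, ∫ y, aux_k a η (x - y) * ρ y ≤ M * K0 + ∫ y, ρ y := by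
    intro η hη x
    exact (integral_mono_ae (hki η hη x) (hV x).1 (hle η hη x)).trans (hV x).2
  have hlim1 : ∀ x, Filter.Tendsto (fun η => ∫ y, aux_k a η (x - y) * ρ y)
      (nhdsWithin 0 (Set.Ioi 0)) (nhds (∫ y, |x - y| ^ (-a) * ρ y)) := by
    intro x
    refine tendsto_integral_filter_of_dominated_convergence (fun y => |x - y| ^ (-a) * ρ y)
      ?_ ?_ (hV x).1 ?_
    · filter_upwards [self_mem_nhdsWithin] with η hη
      exact (hki η hη x).aestronglyMeasurable
    · filter_upwards [self_mem_nhdsWithin] with η hη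
      filter_upwards [hle η hη x] with y hy
      rwa [Real.norm_of_nonneg (mul_nonneg (aux_k_nonneg _ _ _ hη) (h0 y))]
    · filter_upwards [hne x] with y hy
      exact (aux_k_tendsto a _ hy).mul_const _
  have hlim2 : Filter.Tendsto
      (fun η => ∫ x, (∫ y, aux_k a η (x - y) * ρ y) * (ψ' x * ρ x + ψ x * ρ' x))
      (nhdsWithin 0 (Set.Ioi 0))
      (nhds (∫ x, (∫ y, |x - y| ^ (-a) * ρ y) * (ψ' x * ρ x + ψ x * ρ' x))) := by
    refine tendsto_integral_filter_of_dominated_convergence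
      (fun x => (M * K0 + ∫ y, ρ y) * ‖ψ' x * ρ x + ψ x * ρ' x‖) ?_ ?_ (hfi.norm.const_mul _) ?_
    · filter_upwards [self_mem_nhdsWithin] with η hη
      refine AEStronglyMeasurable.mul ?_ hfi.aestronglyMeasurable
      have : StronglyMeasurable (fun x : ℝ => ∫ y, (fun p : ℝ × ℝ => aux_k a η (p.1 - p.2) * ρ p.2) (x, y)) := by
        apply StronglyMeasurable.integral_prod_right
        exact (((aux_k_cont a η hη).comp (by fun_prop)).mul (by fun_prop)).stronglyMeasurable
      exact this.aestronglyMeasurable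
    · filter_upwards [self_mem_nhdsWithin] with η hη
      refine Filter.Eventually.of_forall fun x => ?_
      rw [norm_mul]
      refine mul_le_mul_of_nonneg_right ?_ (norm_nonneg _)
      rw [Real.norm_of_nonneg (integral_nonneg fun y => mul_nonneg (aux_k_nonneg _ _ _ hη) (h0 y))]
      exact hB η hη x
    · exact Filter.Eventually.of_forall fun x => (hlim1 x).mul_const _
  refine ge_of_tendsto hlim2 ?_
  filter_upwards [self_mem_nhdsWithin] with η hη
  exact aux_nonlin_reg a η L _ ha0 hη hL ρ ρ' ψ ψ' hρ hρ' hψ hψ' hs hs' h0 hi hLψ (hB η hη)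

structure AuxCut (χ χ1 χ2 : ℝ → ℝ) (δ R : ℝ) : Prop where
  d0 : ∀ x, HasDerivAt χ (χ1 x) x
  d1 : ∀ x, HasDerivAt χ1 (χ2 x) x
  c2 : Continuous χ2
  even0 : ∀ x, χ (-x) = χ x
  odd1 : ∀ x, χ1 (-x) = - χ1 x
  even2 : ∀ x, χ2 (-x) = χ2 x
  nn : ∀ x, 0 ≤ χ x
  le1 : ∀ x, χ x ≤ 1
  b1 : ∀ x, |χ1 x| ≤ δ
  b2 : ∀ x, |χ2 x| ≤ δ
  z0 : ∀ x, R ≤ |x| → χ x = 0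
  z1 : ∀ x, R ≤ |x| → χ1 x = 0
  z2 : ∀ x, R ≤ |x| → χ2 x = 0

lemma aux_cut_exists (δ n : ℝ) (hδ : 0 < δ) (hn : 0 < n) :
    ∃ χ χ1 χ2 : ℝ → ℝ, ∃ R, AuxCut χ χ1 χ2 δ R ∧ ∀ x, |x| ≤ n → χ x = 1 := by
  let b : ContDiffBump (0:ℝ) := ⟨1, 2, by norm_num, by norm_num⟩
  have hb : ContDiff ℝ 3 (b : ℝ → ℝ) := b.contDiff
  have hd0 : Differentiable ℝ (b : ℝ → ℝ) := hb.differentiable (by norm_num)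
  have hb1 : ContDiff ℝ 2 (deriv (b : ℝ → ℝ)) := by
    exact ContDiff.deriv' (n := 2) hb
  have hd1 : Differentiable ℝ (deriv (b : ℝ → ℝ)) := hb1.differentiable (by norm_num)
  have hb2 : ContDiff ℝ 1 (deriv (deriv (b : ℝ → ℝ))) := by
    exact ContDiff.deriv' (n := 1) hb1
  have hs := b.hasCompactSupport
  have hs1 := hs.deriv
  have hs2 := hs1.deriv
  obtain ⟨C1, hC1⟩ := hs1.exists_bound_of_continuous hb1.continuous
  obtain ⟨C2, hC2⟩ := hs2.exists_bound_of_continuous hb2.continuous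
  have hC10 : 0 ≤ C1 := (norm_nonneg _).trans (hC1 0)
  have hC20 : 0 ≤ C2 := (norm_nonneg _).trans (hC2 0)
  have hev : ∀ x, b (-x) = b x := b.neg
  have hod : ∀ x, deriv b (-x) = - deriv b x := by
    intro x
    have h := deriv_comp_neg (b : ℝ → ℝ) x
    have e : (fun x => b (-x)) = (b : ℝ → ℝ) := funext hev
    rw [e] at h; linarith
  have hev2 : ∀ x, deriv (deriv b) (-x) = deriv (deriv b) x := by
    intro x
    have h := deriv_comp_neg (deriv b) x
    have e : (fun x => deriv b (-x)) = fun x => - deriv b x := funext hod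
    rw [e, deriv.fun_neg] at h; linarith
  have hz : ∀ x, 2 < |x| → b x = 0 ∧ deriv b x = 0 ∧ deriv (deriv b) x = 0 := by
    intro x hx
    have hns : x ∉ tsupport (b : ℝ → ℝ) := by
      rw [b.tsupport_eq]; simp [b]; exact hx
    have hns1 : x ∉ tsupport (deriv (b : ℝ → ℝ)) := fun h => hns (tsupport_deriv_subset h)
    have hns2 : x ∉ tsupport (deriv (deriv (b : ℝ → ℝ))) := fun h => hns1 (tsupport_deriv_subset h)
    exact ⟨image_eq_zero_of_notMem_tsupport hns, image_eq_zero_of_notMem_tsupport hns1,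
      image_eq_zero_of_notMem_tsupport hns2⟩
  obtain ⟨s, hs0, hs1', hsn, hsC1, hsC2⟩ : ∃ s : ℝ, 0 < s ∧ s ≤ 1 ∧ s * n ≤ 1 ∧ s * C1 ≤ δ ∧ s * C2 ≤ δ := by
    refine ⟨min 1 (min (1 / n) (min (δ / (C1 + 1)) (δ / (C2 + 1)))), by positivity, min_le_left _ _, ?_, ?_, ?_⟩
    · rw [← le_div_iff₀ hn]
      exact (min_le_right _ _).trans (min_le_left _ _)
    · have : min 1 (min (1 / n) (min (δ / (C1 + 1)) (δ / (C2 + 1)))) ≤ δ / (C1 + 1) :=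
        (min_le_right _ _).trans ((min_le_right _ _).trans (min_le_left _ _))
      calc _ ≤ δ / (C1 + 1) * C1 := mul_le_mul_of_nonneg_right this hC10
        _ ≤ δ := by rw [div_mul_eq_mul_div, div_le_iff₀ (by positivity)]; nlinarith
    · have : min 1 (min (1 / n) (min (δ / (C1 + 1)) (δ / (C2 + 1)))) ≤ δ / (C2 + 1) :=
        (min_le_right _ _).trans ((min_le_right _ _).trans (min_le_right _ _))
      calc _ ≤ δ / (C2 + 1) * C2 := mul_le_mul_of_nonneg_right this hC20
        _ ≤ δ := by rw [div_mul_eq_mul_div, div_le_iff₀ (by positivity)]; nlinarith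
  have hlin : ∀ x : ℝ, HasDerivAt (fun x => s * x) s x := fun x => by
    simpa using (hasDerivAt_id' x).const_mul s
  have hR : ∀ x, 3 / s ≤ |x| → 2 < |s * x| := by
    intro x hx
    rw [div_le_iff₀ hs0] at hx
    rw [abs_mul, abs_of_pos hs0]; linarith
  refine ⟨fun x => b (s * x), fun x => deriv b (s * x) * s, fun x => deriv (deriv b) (s * x) * s * s,
    3 / s, ⟨?_, ?_, ?_, ?_, ?_, ?_, ?_, ?_, ?_, ?_, ?_, ?_, ?_⟩, ?_⟩
  · intro x
    exact (hd0 (s * x)).hasDerivAt.comp x (hlin x)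
  · intro x
    exact ((hd1 (s * x)).hasDerivAt.comp x (hlin x)).mul_const s
  · have := hb2.continuous
    fun_prop
  · intro x; simp only [mul_neg, hev]
  · intro x; simp only [mul_neg, hod]; ring
  · intro x; simp only [mul_neg, hev2]
  · intro x; exact b.nonneg
  · intro x; exact b.le_one
  · intro x
    have := hC1 (s * x)
    rw [Real.norm_eq_abs] at this
    rw [abs_mul, abs_of_pos hs0]
    nlinarith
  · intro x
    have := hC2 (s * x)
    rw [Real.norm_eq_abs] at this
    rw [abs_mul, abs_mul, abs_of_pos hs0]
    nlinarith [mul_nonneg hs0.le hs0.le, mul_le_mul_of_nonneg_left this (mul_nonneg hs0.le hs0.le), mul_nonneg hs0.le hC20]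
  · intro x hx; exact (hz _ (hR x hx)).1
  · intro x hx; simp only [(hz _ (hR x hx)).2.1, zero_mul]
  · intro x hx; simp only [(hz _ (hR x hx)).2.2, zero_mul]
  · intro x hx
    apply b.one_of_mem_closedBall
    simp only [mem_closedBall_zero_iff, Real.norm_eq_abs, b]
    rw [abs_mul, abs_of_pos hs0]
    nlinarith

lemma aux_cosh (x : ℝ) (hx : 0 ≤ x) : 1 / cosh x / 800 ≤ 1 / (4 * ((1 + x ^ 2) * (1 + x) ^ 2)) := by
  have h1 : x ^ 4 / 24 ≤ exp x := by
    have := Real.pow_div_factorial_le_exp x hx 4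
    norm_num [Nat.factorial] at this
    linarith
  have h2 : 1 ≤ exp x := Real.one_le_exp hx
  have h3 : exp x ≤ 2 * cosh x := by rw [Real.cosh_eq]; linarith [Real.exp_pos (-x)]
  rw [div_div]
  apply one_div_le_one_div_of_le (by positivity)
  have h4 : (1 + x) ^ 2 ≤ 2 * (1 + x ^ 2) := by nlinarith [sq_nonneg (1 - x)]
  have h5 : (1 + x ^ 2) * (1 + x) ^ 2 ≤ 2 * (1 + x ^ 2) ^ 2 := by nlinarith [sq_nonneg x]
  have h6 : (1 + x ^ 2) ^ 2 ≤ 2 + 2 * x ^ 4 := by nlinarith [sq_nonneg (1 - x ^ 2)]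
  nlinarith

lemma aux_pt (x y z : ℝ) (hx : 0 ≤ x) :
    1 / (4 * ((1 + x ^ 2) * (1 + x) ^ 2)) * (y ^ 2 + z ^ 2) ≤
    2 * (1 / (1 + x ^ 2)) * y ^ 2 + (-(2 * x) / (1 + x ^ 2) ^ 2
      + 2 * (-1 / ((1 + x ^ 2) * (1 + x)))) * (z * y)
      + (1 + 2 * x + 3 * x ^ 2) / ((1 + x ^ 2) ^ 2 * (1 + x) ^ 2) * z ^ 2 := by
  have hA : 0 < 2 * (1 + x ^ 2) * (1 + x) ^ 2 - (1 + x ^ 2) / 4 := by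
    have : 1 ≤ (1 + x) ^ 2 := by nlinarith
    nlinarith [sq_nonneg x]
  have key : 0 ≤ (2 * (1 + x ^ 2) * (1 + x) ^ 2 - (1 + x ^ 2) / 4) * y ^ 2
      - 2 * ((1 + x) * (1 + x + 2 * x ^ 2)) * (z * y)
      + (1 + 2 * x + 3 * x ^ 2 - (1 + x ^ 2) / 4) * z ^ 2 := by
    refine nonneg_of_mul_nonneg_right (a := 2 * (1 + x ^ 2) * (1 + x) ^ 2 - (1 + x ^ 2) / 4) ?_ hA
    have hdisc : 0 ≤ (2 * (1 + x ^ 2) * (1 + x) ^ 2 - (1 + x ^ 2) / 4) *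
        (1 + 2 * x + 3 * x ^ 2 - (1 + x ^ 2) / 4) - ((1 + x) * (1 + x + 2 * x ^ 2)) ^ 2 := by
      ring_nf; positivity
    nlinarith [mul_nonneg hdisc (sq_nonneg z), sq_nonneg
      ((2 * (1 + x ^ 2) * (1 + x) ^ 2 - (1 + x ^ 2) / 4) * y - ((1 + x) * (1 + x + 2 * x ^ 2)) * z)]
  have h1x : 0 < 1 + x := by linarith
  have hpos : 0 < (1 + x ^ 2) ^ 2 * (1 + x) ^ 2 := by positivity
  rw [← sub_nonneg]
  have e : 2 * (1 / (1 + x ^ 2)) * y ^ 2 + (-(2 * x) / (1 + x ^ 2) ^ 2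
      + 2 * (-1 / ((1 + x ^ 2) * (1 + x)))) * (z * y)
      + (1 + 2 * x + 3 * x ^ 2) / ((1 + x ^ 2) ^ 2 * (1 + x) ^ 2) * z ^ 2
      - 1 / (4 * ((1 + x ^ 2) * (1 + x) ^ 2)) * (y ^ 2 + z ^ 2)
      = ((2 * (1 + x ^ 2) * (1 + x) ^ 2 - (1 + x ^ 2) / 4) * y ^ 2
      - 2 * ((1 + x) * (1 + x + 2 * x ^ 2)) * (z * y)
      + (1 + 2 * x + 3 * x ^ 2 - (1 + x ^ 2) / 4) * z ^ 2) / ((1 + x ^ 2) ^ 2 * (1 + x) ^ 2) := by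
    field_simp
    ring
  rw [e]
  exact div_nonneg key hpos.le

/-- first derivative of the multiplier -/
noncomputable def auxψ1 (χ χ1 : ℝ → ℝ) (x : ℝ) : ℝ := χ1 x * arctan x + χ x * (1 / (1 + x ^ 2))
/-- second derivative of the multiplier -/
noncomputable def auxψ2 (χ χ1 χ2 : ℝ → ℝ) (x : ℝ) : ℝ :=
  χ2 x * arctan x + 2 * χ1 x * (1 / (1 + x ^ 2)) + χ x * (-(2 * x) / (1 + x ^ 2) ^ 2)

lemma auxψ_d0 {χ χ1 χ2 : ℝ → ℝ} {δ R : ℝ} (hc : AuxCut χ χ1 χ2 δ R) (x : ℝ) :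
    HasDerivAt (fun x => χ x * arctan x) (auxψ1 χ χ1 x) x :=
  (hc.d0 x).mul (Real.hasDerivAt_arctan x)

lemma auxψ_d1 {χ χ1 χ2 : ℝ → ℝ} {δ R : ℝ} (hc : AuxCut χ χ1 χ2 δ R) (x : ℝ) :
    HasDerivAt (auxψ1 χ χ1) (auxψ2 χ χ1 χ2 x) x := by
  have h1 : HasDerivAt (fun x : ℝ => 1 / (1 + x ^ 2)) (-(2 * x) / (1 + x ^ 2) ^ 2) x := by
    have : HasDerivAt (fun x : ℝ => 1 + x ^ 2) (2 * x) x := by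
      simpa using (hasDerivAt_pow 2 x).const_add 1
    have h2 := this.fun_inv (by positivity)
    simpa [one_div] using h2
  have h := ((hc.d1 x).fun_mul (Real.hasDerivAt_arctan x)).fun_add ((hc.d0 x).fun_mul h1)
  have e : auxψ2 χ χ1 χ2 x = χ2 x * arctan x + χ1 x * (1 / (1 + x ^ 2)) +
      (χ1 x * (1 / (1 + x ^ 2)) + χ x * (-(2 * x) / (1 + x ^ 2) ^ 2)) := by
    unfold auxψ2; ring
  rw [e]
  exact h

lemma aux_arctan_le (x : ℝ) : |arctan x| ≤ 2 := by
  rw [abs_le]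
  constructor <;> linarith [Real.arctan_lt_pi_div_two x, Real.neg_pi_div_two_lt_arctan x, Real.pi_lt_four]

lemma aux_cut_cont {χ χ1 χ2 : ℝ → ℝ} {δ R : ℝ} (hc : AuxCut χ χ1 χ2 δ R) :
    Continuous χ ∧ Continuous χ1 :=
  ⟨continuous_iff_continuousAt.2 fun x => (hc.d0 x).continuousAt,
   continuous_iff_continuousAt.2 fun x => (hc.d1 x).continuousAt⟩

lemma auxψ_cont {χ χ1 χ2 : ℝ → ℝ} {δ R : ℝ} (hc : AuxCut χ χ1 χ2 δ R) :
    Continuous (auxψ1 χ χ1) ∧ Continuous (auxψ2 χ χ1 χ2) := by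
  obtain ⟨h0, h1⟩ := aux_cut_cont hc
  have h2 := hc.c2
  have h3 := Real.continuous_arctan
  have h4 : Continuous (fun x : ℝ => 1 / (1 + x ^ 2)) := by
    apply Continuous.div (by fun_prop) (by fun_prop); intro x; positivity
  have h5 : Continuous (fun x : ℝ => -(2 * x) / (1 + x ^ 2) ^ 2) := by
    apply Continuous.div (by fun_prop) (by fun_prop); intro x; positivity
  constructor
  · unfold auxψ1; exact (h1.mul h3).add (h0.mul h4)
  · unfold auxψ2; exact ((h2.mul h3).add ((h1.const_mul 2).mul h4)).add (h0.mul h5)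

lemma auxψ_zero {χ χ1 χ2 : ℝ → ℝ} {δ R : ℝ} (hc : AuxCut χ χ1 χ2 δ R) (x : ℝ) (hx : R ≤ |x|) :
    χ x * arctan x = 0 ∧ auxψ1 χ χ1 x = 0 ∧ auxψ2 χ χ1 χ2 x = 0 := by
  simp [auxψ1, auxψ2, hc.z0 x hx, hc.z1 x hx, hc.z2 x hx]

lemma aux_bdd_of_zero {f : ℝ → ℝ} {R : ℝ} (hz : ∀ x, R ≤ |x| → f x = 0) : HasCompactSupport f := by
  apply HasCompactSupport.intro (isCompact_Icc (a := -R) (b := R))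
  intro x hx
  apply hz
  by_contra h
  push Not at h
  exact hx ⟨(abs_lt.1 h).1.le, (abs_lt.1 h).2.le⟩

lemma aux_coer {χ χ1 χ2 : ℝ → ℝ} {δ R : ℝ} (hc : AuxCut χ χ1 χ2 δ R)
    (p q p1 q1 : ℝ → ℝ) (hp : ∀ x, HasDerivAt p (p1 x) x) (hq : ∀ x, HasDerivAt q (q1 x) x)
    (hp1 : Continuous p1) (hq1 : Continuous q1)
    (op : ∀ x, p (-x) = - p x) (oq : ∀ x, q (-x) = - q x)
    (ep : ∀ x, p1 (-x) = p1 x) (eq : ∀ x, q1 (-x) = q1 x)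
    (hi : Integrable (fun x => p1 x ^ 2 + q1 x ^ 2 + (p x ^ 2 + q x ^ 2))) :
    (∫ x, χ x * (1 / cosh x) * (p1 x ^ 2 + q1 x ^ 2 + (p x ^ 2 + q x ^ 2))) / 800
      - 10 * δ * ∫ x, (p1 x ^ 2 + q1 x ^ 2 + (p x ^ 2 + q x ^ 2)) ≤
    ∫ x, (2 * auxψ1 χ χ1 x * (p1 x ^ 2 + q1 x ^ 2) + auxψ2 χ χ1 χ2 x * (p x * p1 x + q x * q1 x)) := by
  have hpc : Continuous p := continuous_iff_continuousAt.2 fun x => (hp x).continuousAt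
  have hqc : Continuous q := continuous_iff_continuousAt.2 fun x => (hq x).continuousAt
  obtain ⟨hχ, hχ1⟩ := aux_cut_cont hc
  obtain ⟨hψ1, hψ2⟩ := auxψ_cont hc
  have hδ : 0 ≤ δ := (abs_nonneg _).trans (hc.b1 0)
  set N : ℝ → ℝ := fun x => p1 x ^ 2 + q1 x ^ 2 + (p x ^ 2 + q x ^ 2) with hN
  set Q : ℝ → ℝ := fun x => 2 * auxψ1 χ χ1 x * (p1 x ^ 2 + q1 x ^ 2)
    + auxψ2 χ χ1 χ2 x * (p x * p1 x + q x * q1 x) with hQ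
  set J : ℝ → ℝ := fun x => χ x * (1 / cosh x) * N x with hJ
  have hNc : Continuous N := by fun_prop
  have hch : Continuous (fun x : ℝ => 1 / cosh x) := by
    apply Continuous.div (by fun_prop) Real.continuous_cosh; intro x; positivity
  have hJi : Integrable J := by
    apply Continuous.integrable_of_hasCompactSupport ((hχ.mul hch).mul hNc)
    exact aux_bdd_of_zero (R := R) fun x hx => by simp [hc.z0 x hx]
  have hQi : Integrable Q := by
    apply Continuous.integrable_of_hasCompactSupport (by fun_prop)
    refine aux_bdd_of_zero (R := R) fun x hx => ?_
    obtain ⟨_, h1, h2⟩ := auxψ_zero hc x hx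
    simp [hQ, h1, h2]
  set F : ℝ → ℝ := fun x => Q x - J x / 800 + 10 * δ * N x with hF
  have hFi : Integrable F := (hQi.sub (hJi.div_const _)).add (hi.const_mul _)
  have hFint : ∫ x, F x = (∫ x, Q x) - (∫ x, J x) / 800 + 10 * δ * ∫ x, N x := by
    have hs : Integrable (fun x => Q x - J x / 800) := hQi.sub (hJi.div_const _)
    rw [← integral_div, ← integral_const_mul, ← integral_sub hQi (hJi.div_const _),
      ← integral_add hs (hi.const_mul _)]
  suffices h : 0 ≤ ∫ x, F x by rw [hFint] at h; linarith
  have hFe : ∀ x, F (-x) = F x := by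
    intro x
    simp only [hF, hQ, hJ, hN, auxψ1, auxψ2, op, oq, ep, eq, hc.even0, hc.odd1, hc.even2,
      Real.arctan_neg, Real.cosh_neg]
    ring
  have hFabs : ∀ x, F |x| = F x := by
    intro x
    rcases abs_choice x with h | h <;> rw [h]
    exact hFe x
  have hdouble : ∫ x, F x = 2 * ∫ x in Set.Ioi (0:ℝ), F x := by
    rw [← integral_comp_abs]; simp_rw [hFabs]
  rw [hdouble]
  refine mul_nonneg (by norm_num) ?_
  -- the boundary term
  set k : ℝ → ℝ := fun x => -1 / ((1 + x ^ 2) * (1 + x)) with hk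
  set k1 : ℝ → ℝ := fun x => (1 + 2 * x + 3 * x ^ 2) / ((1 + x ^ 2) ^ 2 * (1 + x) ^ 2) with hk1
  have hkd : ∀ x, 0 ≤ x → HasDerivAt k (k1 x) x := by
    intro x hx
    have h1 : HasDerivAt (fun x : ℝ => (1 + x ^ 2) * (1 + x)) (2 * x * (1 + x) + (1 + x ^ 2) * 1) x := by
      refine HasDerivAt.fun_mul ?_ ?_
      · simpa using (hasDerivAt_pow 2 x).const_add 1
      · simpa using (hasDerivAt_id' x).const_add 1
    have hne : (1 + x ^ 2) * (1 + x) ≠ 0 := by positivity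
    have h2 := (h1.fun_inv hne).neg
    have e : k1 x = -(-(2 * x * (1 + x) + (1 + x ^ 2) * 1) / ((1 + x ^ 2) * (1 + x)) ^ 2) := by
      simp only [hk1]
      rw [← mul_pow]
      ring
    rw [e]
    refine h2.congr_of_eventuallyEq (Filter.Eventually.of_forall fun y => ?_)
    change -1 / ((1 + y ^ 2) * (1 + y)) = -((1 + y ^ 2) * (1 + y))⁻¹
    rw [neg_div, one_div]
  set G1 : ℝ → ℝ := fun x => χ1 x * k x * (p x ^ 2 + q x ^ 2) + χ x * k1 x * (p x ^ 2 + q x ^ 2)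
    + 2 * χ x * k x * (p x * p1 x + q x * q1 x) with hG1
  have hGd : ∀ x ∈ Set.Ici (0:ℝ), HasDerivAt (fun x => χ x * k x * (p x ^ 2 + q x ^ 2)) (G1 x) x := by
    intro x hx
    have h := ((hc.d0 x).fun_mul (hkd x hx)).fun_mul (((hp x).fun_pow 2).fun_add ((hq x).fun_pow 2))
    refine h.congr_deriv ?_
    simp only [hG1]; push_cast; ring
  have hkb : ∀ x, 0 ≤ x → |k x| ≤ 1 := by
    intro x hx
    simp only [hk]
    rw [abs_div, abs_neg, abs_one, div_le_one (by positivity), abs_of_nonneg (by positivity)]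
    nlinarith [mul_nonneg (sq_nonneg x) hx, sq_nonneg x]
  have hk1b : ∀ x, 0 ≤ x → 0 ≤ k1 x ∧ k1 x ≤ 3 := by
    intro x hx
    simp only [hk1]
    refine ⟨by positivity, ?_⟩
    rw [div_le_iff₀ (by positivity)]
    have : 1 ≤ (1 + x ^ 2) ^ 2 := by nlinarith [sq_nonneg x, sq_nonneg (x ^ 2)]
    nlinarith [mul_nonneg (sub_nonneg.2 this) (sq_nonneg (1 + x))]
  have hZ : ∀ x, |p x * p1 x + q x * q1 x| ≤ N x / 2 := by
    intro x
    simp only [hN]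
    rw [abs_le]
    constructor <;> nlinarith [sq_nonneg (p x + p1 x), sq_nonneg (q x + q1 x),
      sq_nonneg (p x - p1 x), sq_nonneg (q x - q1 x)]
  have hSN : ∀ x, p x ^ 2 + q x ^ 2 ≤ N x := by
    intro x; simp only [hN]; nlinarith [sq_nonneg (p1 x), sq_nonneg (q1 x)]
  have hAN : ∀ x, p1 x ^ 2 + q1 x ^ 2 ≤ N x := by
    intro x; simp only [hN]; nlinarith [sq_nonneg (p x), sq_nonneg (q x)]
  have hS0 : ∀ x, 0 ≤ p x ^ 2 + q x ^ 2 := fun x => by positivity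
  have hA0 : ∀ x, 0 ≤ p1 x ^ 2 + q1 x ^ 2 := fun x => by positivity
  have hG1i : IntegrableOn G1 (Set.Ioi 0) := by
    refine Integrable.mono' ((hi.const_mul (δ + 4)).integrableOn (s := Set.Ioi 0)) ?_ ?_
    · apply Measurable.aestronglyMeasurable
      have m1 := hχ.measurable
      have m2 := hχ1.measurable
      have m3 := hpc.measurable
      have m4 := hqc.measurable
      have m5 := hp1.measurable
      have m6 := hq1.measurable
      simp only [hG1, hk, hk1]
      fun_prop
    · rw [ae_restrict_iff' measurableSet_Ioi]
      refine Filter.Eventually.of_forall fun x hx => ?_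
      have hx0 : 0 ≤ x := le_of_lt hx
      have e1 : |χ1 x * k x * (p x ^ 2 + q x ^ 2)| ≤ δ * 1 * N x := by
        rw [abs_mul, abs_mul, abs_of_nonneg (hS0 x)]
        exact mul_le_mul (mul_le_mul (hc.b1 x) (hkb x hx0) (abs_nonneg _) hδ) (hSN x) (hS0 x) (by positivity)
      have e2 : |χ x * k1 x * (p x ^ 2 + q x ^ 2)| ≤ 1 * 3 * N x := by
        rw [abs_mul, abs_mul, abs_of_nonneg (hS0 x), abs_of_nonneg (hc.nn x), abs_of_nonneg (hk1b x hx0).1]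
        exact mul_le_mul (mul_le_mul (hc.le1 x) (hk1b x hx0).2 (hk1b x hx0).1 zero_le_one) (hSN x) (hS0 x) (by positivity)
      have e3 : |2 * χ x * k x * (p x * p1 x + q x * q1 x)| ≤ 2 * 1 * 1 * (N x / 2) := by
        rw [abs_mul, abs_mul, abs_mul, abs_of_nonneg (hc.nn x), abs_two]
        exact mul_le_mul (mul_le_mul (by linarith [hc.le1 x]) (hkb x hx0) (abs_nonneg _) (by norm_num)) (hZ x) (abs_nonneg _) (by norm_num)
      rw [Real.norm_eq_abs]
      simp only [hG1]
      refine (abs_add_le _ _).trans ?_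
      have := abs_add_le (χ1 x * k x * (p x ^ 2 + q x ^ 2)) (χ x * k1 x * (p x ^ 2 + q x ^ 2))
      linarith
  have hG1int : ∫ x in Set.Ioi (0:ℝ), G1 x = 0 := by
    have hp0 : p 0 = 0 := by have := op 0; rw [neg_zero] at this; linarith
    have hq0 : q 0 = 0 := by have := oq 0; rw [neg_zero] at this; linarith
    have ht : Filter.Tendsto (fun x => χ x * k x * (p x ^ 2 + q x ^ 2)) Filter.atTop (nhds 0) := by
      refine tendsto_const_nhds.congr' ?_
      filter_upwards [Filter.eventually_ge_atTop R] with x hx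
      rw [hc.z0 x (hx.trans (le_abs_self x))]; ring
    rw [integral_Ioi_of_hasDerivAt_of_tendsto' hGd hG1i ht, hp0, hq0]; ring
  have hadd : ∫ x in Set.Ioi (0:ℝ), F x = ∫ x in Set.Ioi (0:ℝ), (F x + G1 x) := by
    rw [integral_add hFi.integrableOn hG1i, hG1int, add_zero]
  rw [hadd]
  refine setIntegral_nonneg measurableSet_Ioi fun x hx => ?_
  have hx0 : 0 ≤ x := le_of_lt hx
  have i1 := aux_pt x (p1 x) (p x) hx0
  have i2 := aux_pt x (q1 x) (q x) hx0
  have i3 := aux_cosh x hx0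
  have hN0 : 0 ≤ N x := (hS0 x).trans (hSN x)
  have main : χ x * (1 / cosh x / 800 * N x) ≤ χ x * (2 * (1 / (1 + x ^ 2)) * (p1 x ^ 2 + q1 x ^ 2)
      + (-(2 * x) / (1 + x ^ 2) ^ 2 + 2 * k x) * (p x * p1 x + q x * q1 x)
      + k1 x * (p x ^ 2 + q x ^ 2)) := by
    refine mul_le_mul_of_nonneg_left ?_ (hc.nn x)
    refine (mul_le_mul_of_nonneg_right i3 hN0).trans ?_
    simp only [hN, hk, hk1]
    linarith
  have hw : |1 / (1 + x ^ 2)| ≤ 1 := by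
    rw [abs_of_nonneg (by positivity), div_le_one (by positivity)]; nlinarith [sq_nonneg x]
  have e1 : |χ1 x * k x * (p x ^ 2 + q x ^ 2)| ≤ δ * 1 * N x := by
    rw [abs_mul, abs_mul, abs_of_nonneg (hS0 x)]
    exact mul_le_mul (mul_le_mul (hc.b1 x) (hkb x hx0) (abs_nonneg _) hδ) (hSN x) (hS0 x) (by positivity)
  have e2 : |χ1 x * arctan x * (p1 x ^ 2 + q1 x ^ 2)| ≤ δ * 2 * N x := by
    rw [abs_mul, abs_mul, abs_of_nonneg (hA0 x)]
    exact mul_le_mul (mul_le_mul (hc.b1 x) (aux_arctan_le x) (abs_nonneg _) hδ) (hAN x) (hA0 x) (by positivity)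
  have e3 : |χ2 x * arctan x * (p x * p1 x + q x * q1 x)| ≤ δ * 2 * (N x / 2) := by
    rw [abs_mul, abs_mul]
    exact mul_le_mul (mul_le_mul (hc.b2 x) (aux_arctan_le x) (abs_nonneg _) hδ) (hZ x) (abs_nonneg _) (by positivity)
  have e4 : |χ1 x * (1 / (1 + x ^ 2)) * (p x * p1 x + q x * q1 x)| ≤ δ * 1 * (N x / 2) := by
    rw [abs_mul, abs_mul]
    exact mul_le_mul (mul_le_mul (hc.b1 x) hw (abs_nonneg _) hδ) (hZ x) (abs_nonneg _) (by positivity)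
  have hδN : 0 ≤ δ * N x := mul_nonneg hδ hN0
  have f1 := (abs_le.1 e1).1
  have f2 := (abs_le.1 e2).1
  have f3 := (abs_le.1 e3).1
  have f4 := (abs_le.1 e4).1
  have expand : F x + G1 x = χ x * (2 * (1 / (1 + x ^ 2)) * (p1 x ^ 2 + q1 x ^ 2)
      + (-(2 * x) / (1 + x ^ 2) ^ 2 + 2 * k x) * (p x * p1 x + q x * q1 x)
      + k1 x * (p x ^ 2 + q x ^ 2)) - χ x * (1 / cosh x / 800 * N x)
      + (χ1 x * k x * (p x ^ 2 + q x ^ 2)) + 2 * (χ1 x * arctan x * (p1 x ^ 2 + q1 x ^ 2))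
      + (χ2 x * arctan x * (p x * p1 x + q x * q1 x))
      + 2 * (χ1 x * (1 / (1 + x ^ 2)) * (p x * p1 x + q x * q1 x)) + 10 * (δ * N x) := by
    simp only [hF, hQ, hJ, hG1, auxψ1, auxψ2]
    ring
  rw [expand]
  linarith

/-- time derivative -/
noncomputable def auxDt (F : ℝ × ℝ → ℝ) (p : ℝ × ℝ) : ℝ := fderiv ℝ F p (1, 0)
/-- space derivative -/
noncomputable def auxDx (F : ℝ × ℝ → ℝ) (p : ℝ × ℝ) : ℝ := fderiv ℝ F p (0, 1)

lemma auxDt_smooth {F : ℝ × ℝ → ℝ} (hF : ContDiff ℝ (⊤ : ℕ∞) F) : ContDiff ℝ (⊤ : ℕ∞) (auxDt F) :=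
  (hF.fderiv_right (m := (⊤ : ℕ∞)) (by simp)).clm_apply contDiff_const

lemma auxDx_smooth {F : ℝ × ℝ → ℝ} (hF : ContDiff ℝ (⊤ : ℕ∞) F) : ContDiff ℝ (⊤ : ℕ∞) (auxDx F) :=
  (hF.fderiv_right (m := (⊤ : ℕ∞)) (by simp)).clm_apply contDiff_const

lemma auxDt_has {F : ℝ × ℝ → ℝ} (hF : ContDiff ℝ (⊤ : ℕ∞) F) (t x : ℝ) :
    HasDerivAt (fun s => F (s, x)) (auxDt F (t, x)) t := by
  have h1 : HasFDerivAt F (fderiv ℝ F (t, x)) (t, x) :=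
    (hF.differentiable (by simp) (t, x)).hasFDerivAt
  have h2 : HasDerivAt (fun s : ℝ => (s, x)) ((1 : ℝ), (0 : ℝ)) t :=
    (hasDerivAt_id' t).prodMk (hasDerivAt_const t x)
  exact h1.comp_hasDerivAt t h2

lemma auxDx_has {F : ℝ × ℝ → ℝ} (hF : ContDiff ℝ (⊤ : ℕ∞) F) (t x : ℝ) :
    HasDerivAt (fun y => F (t, y)) (auxDx F (t, x)) x := by
  have h1 : HasFDerivAt F (fderiv ℝ F (t, x)) (t, x) :=
    (hF.differentiable (by simp) (t, x)).hasFDerivAt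
  have h2 : HasDerivAt (fun s : ℝ => (t, s)) ((0 : ℝ), (1 : ℝ)) x :=
    (hasDerivAt_const x t).prodMk (hasDerivAt_id' x)
  exact h1.comp_hasDerivAt x h2

lemma auxD_comm {F : ℝ × ℝ → ℝ} (hF : ContDiff ℝ (⊤ : ℕ∞) F) (p : ℝ × ℝ) :
    auxDt (auxDx F) p = auxDx (auxDt F) p := by
  have hd : DifferentiableAt ℝ (fderiv ℝ F) p :=
    (hF.fderiv_right (m := (⊤ : ℕ∞)) (by simp)).differentiable (by simp) p
  have e : ∀ v w : ℝ × ℝ, fderiv ℝ (fun p => fderiv ℝ F p v) p w = fderiv ℝ (fderiv ℝ F) p w v := by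
    intro v w
    rw [fderiv_clm_apply hd (differentiableAt_const v)]
    simp
  have hsym : IsSymmSndFDerivAt ℝ F p :=
    hF.contDiffAt.isSymmSndFDerivAt (by simp only [minSmoothness_of_isRCLikeNormedField]; exact WithTop.coe_le_coe.2 (le_top : (2 : ℕ∞) ≤ ⊤))
  change fderiv ℝ (fun p => fderiv ℝ F p (0, 1)) p (1, 0)
    = fderiv ℝ (fun p => fderiv ℝ F p (1, 0)) p (0, 1)
  rw [e, e]
  exact hsym _ _

lemma aux_param (ψ : ℝ → ℝ) (R : ℝ) (hψ : Continuous ψ) (hz : ∀ x, R ≤ |x| → ψ x = 0)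
    (m m1 : ℝ × ℝ → ℝ) (hm : Continuous m) (hm1 : Continuous m1)
    (hd : ∀ t x, HasDerivAt (fun s => m (s, x)) (m1 (t, x)) t) (t : ℝ) :
    HasDerivAt (fun s => ∫ x, ψ x * m (s, x)) (∫ x, ψ x * m1 (t, x)) t := by
  obtain ⟨C, hC⟩ := (isCompact_Icc (a := t - 1) (b := t + 1)).prod (isCompact_Icc (a := -R) (b := R))
    |>.exists_bound_of_continuousOn hm1.continuousOn
  have hcs : HasCompactSupport ψ := aux_bdd_of_zero hz
  refine (hasDerivAt_integral_of_dominated_loc_of_deriv_le (F := fun s x => ψ x * m (s, x))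
    (F' := fun s x => ψ x * m1 (s, x)) (s := Set.Icc (t - 1) (t + 1))
    (bound := fun x => |ψ x| * C) (Icc_mem_nhds (by linarith) (by linarith)) ?_ ?_ ?_ ?_ ?_ ?_).2
  · exact Filter.Eventually.of_forall fun s => (hψ.mul (hm.comp (by fun_prop))).aestronglyMeasurable
  · apply Continuous.integrable_of_hasCompactSupport (hψ.mul (hm.comp (by fun_prop)))
    exact hcs.mul_right
  · exact (hψ.mul (hm1.comp (by fun_prop))).aestronglyMeasurable
  · refine Filter.Eventually.of_forall fun x s hs => ?_
    rw [norm_mul, Real.norm_eq_abs]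
    by_cases h : R ≤ |x|
    · rw [hz x h]; simp
    · push Not at h
      exact mul_le_mul_of_nonneg_left
        (hC (s, x) ⟨hs, (abs_lt.1 h).1.le, (abs_lt.1 h).2.le⟩) (abs_nonneg _)
  · apply Integrable.mul_const
    exact (hψ.integrable_of_hasCompactSupport hcs).abs
  · exact Filter.Eventually.of_forall fun x s _ => (hd s x).const_mul (ψ x)

lemma aux_virial (P Q : ℝ × ℝ → ℝ) (hP : ContDiff ℝ (⊤ : ℕ∞) P) (hQ : ContDiff ℝ (⊤ : ℕ∞) Q)
    (ψ ψ1 ψ2 : ℝ → ℝ) (R : ℝ) (d0 : ∀ x, HasDerivAt ψ (ψ1 x) x) (d1 : ∀ x, HasDerivAt ψ1 (ψ2 x) x)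
    (c2 : Continuous ψ2) (z : ∀ x, R ≤ |x| → ψ x = 0 ∧ ψ1 x = 0 ∧ ψ2 x = 0)
    (t : ℝ) (V : ℝ → ℝ)
    (e1 : ∀ x, - auxDt Q (t, x) + auxDx (auxDx P) (t, x) = V x * P (t, x))
    (e2 : ∀ x, auxDt P (t, x) + auxDx (auxDx Q) (t, x) = V x * Q (t, x)) :
    HasDerivAt (fun s => ∫ x, ψ x * (P (s, x) * auxDx Q (s, x) - Q (s, x) * auxDx P (s, x)))
      ((∫ x, V x * (ψ1 x * (P (t, x) ^ 2 + Q (t, x) ^ 2) +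
          ψ x * (2 * (P (t, x) * auxDx P (t, x) + Q (t, x) * auxDx Q (t, x)))))
        + ∫ x, (2 * ψ1 x * (auxDx P (t, x) ^ 2 + auxDx Q (t, x) ^ 2)
          + ψ2 x * (P (t, x) * auxDx P (t, x) + Q (t, x) * auxDx Q (t, x)))) t := by
  have hψ : Continuous ψ := continuous_iff_continuousAt.2 fun x => (d0 x).continuousAt
  have hψ1 : Continuous ψ1 := continuous_iff_continuousAt.2 fun x => (d1 x).continuousAt
  have hPt := auxDt_smooth hP
  have hQt := auxDt_smooth hQ
  have hPx := auxDx_smooth hP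
  have hQx := auxDx_smooth hQ
  have hPxx := auxDx_smooth hPx
  have hQxx := auxDx_smooth hQx
  have hPxt := auxDt_smooth hPx
  have hQxt := auxDt_smooth hQx
  have k1 := hP.continuous
  have k2 := hQ.continuous
  have k3 := hPt.continuous
  have k4 := hQt.continuous
  have k5 := hPx.continuous
  have k6 := hQx.continuous
  have k7 := hPxx.continuous
  have k8 := hQxx.continuous
  have k9 := hPxt.continuous
  have k10 := hQxt.continuous
  set m1 : ℝ × ℝ → ℝ := fun p => auxDt P p * auxDx Q p + P p * auxDt (auxDx Q) p
    - (auxDt Q p * auxDx P p + Q p * auxDt (auxDx P) p) with hm1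
  have hpar := aux_param ψ R hψ (fun x hx => (z x hx).1)
    (fun p => P p * auxDx Q p - Q p * auxDx P p) m1 (by fun_prop) (by fun_prop)
    (fun s x => ((auxDt_has hP s x).fun_mul (auxDt_has hQx s x)).fun_sub
      ((auxDt_has hQ s x).fun_mul (auxDt_has hPx s x))) t
  set E : ℝ → ℝ := fun x => ψ x * (P (t, x) * auxDt Q (t, x) - Q (t, x) * auxDt P (t, x))
    - ψ x * (auxDx P (t, x) ^ 2 + auxDx Q (t, x) ^ 2)
    - ψ1 x * (P (t, x) * auxDx P (t, x) + Q (t, x) * auxDx Q (t, x)) with hE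
  set E1 : ℝ → ℝ := fun x =>
    (ψ1 x * (P (t, x) * auxDt Q (t, x) - Q (t, x) * auxDt P (t, x))
    + ψ x * (auxDx P (t, x) * auxDt Q (t, x) + P (t, x) * auxDt (auxDx Q) (t, x)
      - (auxDx Q (t, x) * auxDt P (t, x) + Q (t, x) * auxDt (auxDx P) (t, x))))
    - (ψ1 x * (auxDx P (t, x) ^ 2 + auxDx Q (t, x) ^ 2)
      + ψ x * (2 * auxDx P (t, x) * auxDx (auxDx P) (t, x) + 2 * auxDx Q (t, x) * auxDx (auxDx Q) (t, x)))
    - (ψ2 x * (P (t, x) * auxDx P (t, x) + Q (t, x) * auxDx Q (t, x))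
      + ψ1 x * (auxDx P (t, x) * auxDx P (t, x) + P (t, x) * auxDx (auxDx P) (t, x)
        + (auxDx Q (t, x) * auxDx Q (t, x) + Q (t, x) * auxDx (auxDx Q) (t, x)))) with hE1
  have hEd : ∀ x, HasDerivAt E (E1 x) x := by
    intro x
    have a1 := auxDx_has hP t x
    have a2 := auxDx_has hQ t x
    have a3 := auxDx_has hPt t x
    have a4 := auxDx_has hQt t x
    have a5 := auxDx_has hPx t x
    have a6 := auxDx_has hQx t x
    rw [← auxD_comm hP] at a3
    rw [← auxD_comm hQ] at a4
    have h := (((d0 x).fun_mul ((a1.fun_mul a4).fun_sub (a2.fun_mul a3))).fun_sub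
      ((d0 x).fun_mul ((a5.fun_pow 2).fun_add (a6.fun_pow 2)))).fun_sub
      ((d1 x).fun_mul ((a1.fun_mul a5).fun_add (a2.fun_mul a6)))
    refine h.congr_deriv ?_
    simp only [hE1]; push_cast; ring
  have hE1i : Integrable E1 := by
    apply Continuous.integrable_of_hasCompactSupport (by fun_prop)
    refine aux_bdd_of_zero (R := R) fun x hx => ?_
    obtain ⟨z0, z1, z2⟩ := z x hx
    simp [hE1, z0, z1, z2]
  have hEi : Integrable E := by
    apply Continuous.integrable_of_hasCompactSupport (by fun_prop)
    refine aux_bdd_of_zero (R := R) fun x hx => ?_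
    obtain ⟨z0, z1, z2⟩ := z x hx
    simp [hE, z0, z1]
  have hE0 : ∫ x, E1 x = 0 := integral_eq_zero_of_hasDerivAt_of_integrable hEd hE1i hEi
  set B : ℝ → ℝ := fun x => 2 * ψ1 x * (auxDx P (t, x) ^ 2 + auxDx Q (t, x) ^ 2)
          + ψ2 x * (P (t, x) * auxDx P (t, x) + Q (t, x) * auxDx Q (t, x)) with hB
  have hBi : Integrable B := by
    apply Continuous.integrable_of_hasCompactSupport (by fun_prop)
    refine aux_bdd_of_zero (R := R) fun x hx => ?_
    obtain ⟨z0, z1, z2⟩ := z x hx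
    simp [hB, z1, z2]
  have hMi : Integrable (fun x => ψ x * m1 (t, x)) := by
    apply Continuous.integrable_of_hasCompactSupport (by fun_prop)
    refine aux_bdd_of_zero (R := R) fun x hx => ?_
    obtain ⟨z0, z1, z2⟩ := z x hx
    simp [z0]
  have hid : ∀ x, V x * (ψ1 x * (P (t, x) ^ 2 + Q (t, x) ^ 2) +
          ψ x * (2 * (P (t, x) * auxDx P (t, x) + Q (t, x) * auxDx Q (t, x))))
      = ψ x * m1 (t, x) - B x - E1 x := by
    intro x
    have f1 := e1 x
    have f2 := e2 x
    simp only [hm1, hB, hE1]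
    linear_combination (-(ψ1 x) * P (t, x) - 2 * ψ x * auxDx P (t, x)) * f1
      + (-(ψ1 x) * Q (t, x) - 2 * ψ x * auxDx Q (t, x)) * f2
  have hval : (∫ x, V x * (ψ1 x * (P (t, x) ^ 2 + Q (t, x) ^ 2) +
          ψ x * (2 * (P (t, x) * auxDx P (t, x) + Q (t, x) * auxDx Q (t, x)))))
        + ∫ x, B x = ∫ x, ψ x * m1 (t, x) := by
    simp_rw [hid]
    have hs : Integrable (fun x => ψ x * m1 (t, x) - B x) := hMi.sub hBi
    rw [integral_sub hs hE1i, integral_sub hMi hBi, hE0]; ring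
  rw [hval]
  exact hpar

lemma aux_core (a : ℝ) (ha0 : 0 < a) (ha1 : a < 1) (ε : ℝ) (P Q : ℝ × ℝ → ℝ)
    (hP : ContDiff ℝ (⊤ : ℕ∞) P) (hQ : ContDiff ℝ (⊤ : ℕ∞) Q)
    (oP : ∀ t x, P (t, -x) = - P (t, x)) (oQ : ∀ t x, Q (t, -x) = - Q (t, x))
    (i0 : ∀ t, Integrable (fun x => P (t, x) ^ 2 + Q (t, x) ^ 2))
    (i1 : ∀ t, Integrable (fun x => auxDx P (t, x) ^ 2 + auxDx Q (t, x) ^ 2))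
    (hs : ∀ t x, P (t, x) ^ 2 + Q (t, x) ^ 2 ≤ ε ^ 2)
    (hb : ∀ t, (∫ x, P (t, x) ^ 2 + Q (t, x) ^ 2)
      + (∫ x, auxDx P (t, x) ^ 2 + auxDx Q (t, x) ^ 2) ≤ ε ^ 2)
    (e1 : ∀ t x, - auxDt Q (t, x) + auxDx (auxDx P) (t, x)
      = (∫ y, |x - y| ^ (-a) * (P (t, y) ^ 2 + Q (t, y) ^ 2)) * P (t, x))
    (e2 : ∀ t x, auxDt P (t, x) + auxDx (auxDx Q) (t, x)
      = (∫ y, |x - y| ^ (-a) * (P (t, y) ^ 2 + Q (t, y) ^ 2)) * Q (t, x))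
    (n T : ℝ) (hn : 0 < n) (hT : 0 < T) :
    ∫ t in (0 : ℝ)..T, ∫ x in (-n)..n, (1 / cosh x) *
      (auxDx P (t, x) ^ 2 + auxDx Q (t, x) ^ 2 + (P (t, x) ^ 2 + Q (t, x) ^ 2)) ≤ 1600 * ε ^ 2 := by
  obtain ⟨K0, hK0, hNL⟩ := aux_nonlin a ha0 ha1
  have hPx := auxDx_smooth hP
  have hQx := auxDx_smooth hQ
  have k1 := hP.continuous
  have k2 := hQ.continuous
  have k5 := hPx.continuous
  have k6 := hQx.continuous
  have eP : ∀ t x, auxDx P (t, -x) = auxDx P (t, x) := by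
    intro t x
    have h1 : HasDerivAt (fun y => P (t, -y)) (- auxDx P (t, -x)) x := by
      have := (auxDx_has hP t (-x)).scomp x (hasDerivAt_neg x)
      simpa [Function.comp_def] using this
    have h2 : HasDerivAt (fun y => P (t, -y)) (- auxDx P (t, x)) x := by
      have e : (fun y => P (t, -y)) = fun y => - P (t, y) := funext fun y => oP t y
      rw [e]; exact (auxDx_has hP t x).fun_neg
    have := h1.unique h2
    linarith
  have eQ : ∀ t x, auxDx Q (t, -x) = auxDx Q (t, x) := by
    intro t x
    have h1 : HasDerivAt (fun y => Q (t, -y)) (- auxDx Q (t, -x)) x := by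
      have := (auxDx_has hQ t (-x)).scomp x (hasDerivAt_neg x)
      simpa [Function.comp_def] using this
    have h2 : HasDerivAt (fun y => Q (t, -y)) (- auxDx Q (t, x)) x := by
      have e : (fun y => Q (t, -y)) = fun y => - Q (t, y) := funext fun y => oQ t y
      rw [e]; exact (auxDx_has hQ t x).fun_neg
    have := h1.unique h2
    linarith
  have hi : ∀ t, Integrable (fun x => auxDx P (t, x) ^ 2 + auxDx Q (t, x) ^ 2
      + (P (t, x) ^ 2 + Q (t, x) ^ 2)) := fun t => (i1 t).add (i0 t)
  have hN : ∀ t, ∫ x, (auxDx P (t, x) ^ 2 + auxDx Q (t, x) ^ 2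
      + (P (t, x) ^ 2 + Q (t, x) ^ 2)) ≤ ε ^ 2 := by
    intro t
    rw [integral_add (i1 t) (i0 t)]
    linarith [hb t]
  have hm0 : ∀ t, 0 ≤ ∫ x, P (t, x) ^ 2 + Q (t, x) ^ 2 := fun t =>
    integral_nonneg fun x => by positivity
  have hm10 : ∀ t, 0 ≤ ∫ x, auxDx P (t, x) ^ 2 + auxDx Q (t, x) ^ 2 := fun t =>
    integral_nonneg fun x => by positivity
  set G : ℝ → ℝ := fun t => ∫ x in (-n)..n, (1 / cosh x) *
      (auxDx P (t, x) ^ 2 + auxDx Q (t, x) ^ 2 + (P (t, x) ^ 2 + Q (t, x) ^ 2)) with hG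
  have hcosh : Continuous (fun x : ℝ => 1 / cosh x) :=
    continuous_const.div continuous_cosh fun x => (cosh_pos x).ne'
  have hGc : Continuous G := by
    apply intervalIntegral.continuous_parametric_intervalIntegral_of_continuous'
    simp only [Function.uncurry_def]
    exact (hcosh.comp continuous_snd).mul (by fun_prop)
  set C := a * (ε ^ 2 * K0 + ε ^ 2) * ε ^ 2 + 10 * ε ^ 2 with hC
  have hC0 : 0 ≤ C := by positivity
  have main : ∀ δ > 0, ∫ t in (0 : ℝ)..T, G t ≤ 1600 * ε ^ 2 + 800 * T * δ * C := by
    intro δ hδ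
    obtain ⟨χ, χ1, χ2, R, hc, hone⟩ := aux_cut_exists δ n hδ hn
    obtain ⟨hχ, hχ1⟩ := aux_cut_cont hc
    obtain ⟨hψ1, hψ2⟩ := auxψ_cont hc
    set I : ℝ → ℝ := fun s => ∫ x, (χ x * arctan x) *
      (P (s, x) * auxDx Q (s, x) - Q (s, x) * auxDx P (s, x)) with hI
    have hIb : ∀ s, |I s| ≤ ε ^ 2 := by
      intro s
      refine le_trans ?_ (hN s)
      refine (norm_integral_le_of_norm_le (hi s) ?_ : ‖I s‖ ≤ _)
      refine Filter.Eventually.of_forall fun x => ?_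
      rw [norm_mul, norm_mul, Real.norm_eq_abs, Real.norm_eq_abs, Real.norm_eq_abs,
        abs_of_nonneg (hc.nn x)]
      have h1 : χ x * |arctan x| ≤ 2 := by
        have := mul_le_mul (hc.le1 x) (aux_arctan_le x) (abs_nonneg _) zero_le_one
        linarith
      have h2 : |P (s, x) * auxDx Q (s, x) - Q (s, x) * auxDx P (s, x)| ≤
          (auxDx P (s, x) ^ 2 + auxDx Q (s, x) ^ 2 + (P (s, x) ^ 2 + Q (s, x) ^ 2)) / 2 := by
        rw [abs_le]
        constructor
        · nlinarith [sq_nonneg (P (s, x) + auxDx Q (s, x)), sq_nonneg (Q (s, x) - auxDx P (s, x))]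
        · nlinarith [sq_nonneg (P (s, x) - auxDx Q (s, x)), sq_nonneg (Q (s, x) + auxDx P (s, x))]
      have := mul_le_mul h1 h2 (abs_nonneg _) zero_le_two
      linarith
    have hder := fun t => aux_virial P Q hP hQ (fun x => χ x * arctan x) (auxψ1 χ χ1)
      (auxψ2 χ χ1 χ2) R (auxψ_d0 hc) (auxψ_d1 hc) hψ2 (auxψ_zero hc) t
      (fun x => ∫ y, |x - y| ^ (-a) * (P (t, y) ^ 2 + Q (t, y) ^ 2)) (e1 t) (e2 t)
    have hlow : ∀ t, G t / 800 - δ * C ≤ (∫ x, (∫ y, |x - y| ^ (-a) * (P (t, y) ^ 2 + Q (t, y) ^ 2)) *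
          (auxψ1 χ χ1 x * (P (t, x) ^ 2 + Q (t, x) ^ 2) +
          χ x * arctan x * (2 * (P (t, x) * auxDx P (t, x) + Q (t, x) * auxDx Q (t, x)))))
        + ∫ x, (2 * auxψ1 χ χ1 x * (auxDx P (t, x) ^ 2 + auxDx Q (t, x) ^ 2)
          + auxψ2 χ χ1 χ2 x * (P (t, x) * auxDx P (t, x) + Q (t, x) * auxDx Q (t, x))) := by
      intro t
      have hA := hNL (2 * δ) (ε ^ 2) (by positivity) (fun x => P (t, x) ^ 2 + Q (t, x) ^ 2)
        (fun x => 2 * (P (t, x) * auxDx P (t, x) + Q (t, x) * auxDx Q (t, x)))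
        (fun x => χ x * arctan x) (auxψ1 χ χ1)
        (fun x => (((auxDx_has hP t x).fun_pow 2).fun_add ((auxDx_has hQ t x).fun_pow 2)).congr_deriv
          (by push_cast; ring))
        (by fun_prop) (auxψ_d0 hc) hψ1
        (aux_bdd_of_zero fun x hx => (auxψ_zero hc x hx).1)
        (aux_bdd_of_zero fun x hx => (auxψ_zero hc x hx).2.1)
        (fun x => by positivity) (hs t) (i0 t)
        (fun x => by
          unfold auxψ1
          have h1 : 0 ≤ χ x * (1 / (1 + x ^ 2)) := mul_nonneg (hc.nn x) (by positivity)
          have h2 : |χ1 x * arctan x| ≤ δ * 2 := by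
            rw [abs_mul]
            exact mul_le_mul (hc.b1 x) (aux_arctan_le x) (abs_nonneg _) hδ.le
          linarith [(abs_le.1 h2).1])
      have hB := aux_coer hc (fun x => P (t, x)) (fun x => Q (t, x)) (fun x => auxDx P (t, x))
        (fun x => auxDx Q (t, x)) (auxDx_has hP t) (auxDx_has hQ t) (by fun_prop) (by fun_prop)
        (oP t) (oQ t) (eP t) (eQ t) (hi t)
      have hJ : G t ≤ ∫ x, χ x * (1 / cosh x) * (auxDx P (t, x) ^ 2 + auxDx Q (t, x) ^ 2
          + (P (t, x) ^ 2 + Q (t, x) ^ 2)) := by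
        have hint : Integrable (fun x => χ x * (1 / cosh x) * (auxDx P (t, x) ^ 2
            + auxDx Q (t, x) ^ 2 + (P (t, x) ^ 2 + Q (t, x) ^ 2))) := by
          apply Continuous.integrable_of_hasCompactSupport (by fun_prop)
          exact (aux_bdd_of_zero hc.z0).mul_right.mul_right
        have hnn : ∀ x, 0 ≤ χ x * (1 / cosh x) * (auxDx P (t, x) ^ 2
            + auxDx Q (t, x) ^ 2 + (P (t, x) ^ 2 + Q (t, x) ^ 2)) := fun x =>
          mul_nonneg (mul_nonneg (hc.nn x) (one_div_nonneg.2 (cosh_pos x).le)) (by positivity)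
        refine le_trans (le_of_eq ?_) (setIntegral_le_integral (s := Set.Ioc (-n) n) hint
          (Filter.Eventually.of_forall hnn))
        rw [hG]
        simp only []
        rw [intervalIntegral.integral_of_le (by linarith)]
        apply setIntegral_congr_fun measurableSet_Ioc
        intro x hx
        simp only []
        rw [hone x (abs_le.2 ⟨hx.1.le, hx.2⟩), one_mul]
      have hm : ∫ x, P (t, x) ^ 2 + Q (t, x) ^ 2 ≤ ε ^ 2 := by linarith [hb t, hm10 t]
      have hprod : a * (2 * δ) / 2 * (ε ^ 2 * K0 + ∫ x, P (t, x) ^ 2 + Q (t, x) ^ 2) *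
          (∫ x, P (t, x) ^ 2 + Q (t, x) ^ 2) ≤ a * (2 * δ) / 2 * (ε ^ 2 * K0 + ε ^ 2) * ε ^ 2 := by
        have := hm0 t
        gcongr
      have hN' := mul_le_mul_of_nonneg_left (hN t) (by positivity : (0:ℝ) ≤ 10 * δ)
      rw [hC]
      linarith
    have hF := intervalIntegral.integral_le_sub_of_hasDeriv_right_of_le (g := I)
      (φ := fun t => G t / 800 - δ * C) hT.le
      (continuous_iff_continuousAt.2 fun t => (hder t).continuousAt).continuousOn
      (fun t _ => (hder t).hasDerivWithinAt)
      (((hGc.div_const 800).sub continuous_const).integrableOn_Icc)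
      (fun t _ => hlow t)
    rw [intervalIntegral.integral_sub ((hGc.div_const 800).intervalIntegrable _ _)
      (continuous_const.intervalIntegrable _ _), intervalIntegral.integral_div,
      intervalIntegral.integral_const, smul_eq_mul] at hF
    have := abs_le.1 (hIb T)
    have := abs_le.1 (hIb 0)
    linarith
  apply le_of_forall_pos_le_add
  intro η hη
  have := main (η / (800 * T * C + 1)) (by positivity)
  have h2 : 800 * T * (η / (800 * T * C + 1)) * C ≤ η := by
    rw [show 800 * T * (η / (800 * T * C + 1)) * C = η * (800 * T * C) / (800 * T * C + 1) by ring,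
      div_le_iff₀ (by positivity)]
    nlinarith
  linarith

lemma aux_lint (W : ℝ × ℝ → ℝ) (hW : Continuous W) (h0 : ∀ p, 0 ≤ W p)
    (hi : ∀ t, Integrable (fun x => W (t, x))) (B : ℝ)
    (hB : ∀ n T : ℝ, 0 < n → 0 < T → ∫ t in (0 : ℝ)..T, ∫ x in (-n)..n, W (t, x) ≤ B) :
    ∫⁻ t in Set.Ici (0 : ℝ), ENNReal.ofReal (∫ x, W (t, x)) ≤ ENNReal.ofReal B := by
  set G : ℕ → ℝ → ℝ := fun n t => ∫ x in (-((n : ℝ) + 1))..((n : ℝ) + 1), W (t, x) with hG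
  have hGc : ∀ n, Continuous (G n) := by
    intro n
    apply intervalIntegral.continuous_parametric_intervalIntegral_of_continuous'
    simp only [Function.uncurry_def]
    fun_prop
  have hG0 : ∀ n t, 0 ≤ G n t := fun n t =>
    intervalIntegral.integral_nonneg (by have : (0:ℝ) ≤ n := n.cast_nonneg
                                         linarith) fun x _ => h0 _
  set H : ℕ → ℝ → ENNReal := fun n =>
    (Set.Ioc (0 : ℝ) ((n : ℝ) + 1)).indicator (fun t => ENNReal.ofReal (G n t)) with hH
  have hHm : ∀ n, Measurable (H n) := fun n =>
    ((hGc n).measurable.ennreal_ofReal).indicator measurableSet_Ioc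
  have hn1 : Filter.Tendsto (fun n : ℕ => (n : ℝ) + 1) Filter.atTop Filter.atTop :=
    Filter.tendsto_atTop_add_const_right _ _ tendsto_natCast_atTop_atTop
  have hlim : ∀ t ∈ Set.Ioi (0 : ℝ), Filter.Tendsto (fun n => H n t) Filter.atTop
      (nhds (ENNReal.ofReal (∫ x, W (t, x)))) := by
    intro t ht
    have h1 : Filter.Tendsto (fun n => ENNReal.ofReal (G n t)) Filter.atTop
        (nhds (ENNReal.ofReal (∫ x, W (t, x)))) := by
      apply ENNReal.tendsto_ofReal
      exact intervalIntegral_tendsto_integral (hi t) (Filter.tendsto_neg_atTop_atBot.comp hn1) hn1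
    refine h1.congr' ?_
    filter_upwards [hn1.eventually_ge_atTop t] with n hn
    rw [hH]
    simp only []
    rw [Set.indicator_of_mem (show t ∈ Set.Ioc (0:ℝ) ((n:ℝ)+1) from ⟨ht, hn⟩)]
  have hHB : ∀ n, ∫⁻ t, H n t ≤ ENNReal.ofReal B := by
    intro n
    have hp : (0:ℝ) < (n:ℝ) + 1 := by positivity
    rw [hH]
    simp only []
    rw [lintegral_indicator measurableSet_Ioc, ← ofReal_integral_eq_lintegral_ofReal
      (((hGc n).integrableOn_Icc).mono_set Set.Ioc_subset_Icc_self)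
      (Filter.Eventually.of_forall (hG0 n)), ← intervalIntegral.integral_of_le hp.le]
    exact ENNReal.ofReal_le_ofReal (hB _ _ hp hp)
  rw [setLIntegral_congr (Ioi_ae_eq_Ici (a := (0:ℝ))).symm]
  calc ∫⁻ t in Set.Ioi (0 : ℝ), ENNReal.ofReal (∫ x, W (t, x))
      = ∫⁻ t in Set.Ioi (0 : ℝ), Filter.liminf (fun n => H n t) Filter.atTop :=
        setLIntegral_congr_fun measurableSet_Ioi fun t ht => (hlim t ht).liminf_eq.symm
    _ ≤ ∫⁻ t, Filter.liminf (fun n => H n t) Filter.atTop := setLIntegral_le_lintegral _ _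
    _ ≤ Filter.liminf (fun n => ∫⁻ t, H n t) Filter.atTop := lintegral_liminf_le hHm
    _ ≤ Filter.liminf (fun _ : ℕ => ENNReal.ofReal B) Filter.atTop :=
        Filter.liminf_le_liminf (Filter.Eventually.of_forall hHB)
    _ = ENNReal.ofReal B := Filter.liminf_const _

lemma aux_sup (p q p1 q1 : ℝ → ℝ) (B : ℝ) (hp : ∀ x, HasDerivAt p (p1 x) x)
    (hq : ∀ x, HasDerivAt q (q1 x) x) (hp1 : Continuous p1) (hq1 : Continuous q1)
    (i0 : Integrable (fun x => p x ^ 2 + q x ^ 2)) (i1 : Integrable (fun x => p1 x ^ 2 + q1 x ^ 2))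
    (hz : Filter.Tendsto (fun x => p x ^ 2 + q x ^ 2) Filter.atBot (nhds 0))
    (hB : (∫ x, p x ^ 2 + q x ^ 2) + (∫ x, p1 x ^ 2 + q1 x ^ 2) ≤ B) (x : ℝ) :
    p x ^ 2 + q x ^ 2 ≤ B := by
  have hpc : Continuous p := continuous_iff_continuousAt.2 fun x => (hp x).continuousAt
  have hqc : Continuous q := continuous_iff_continuousAt.2 fun x => (hq x).continuousAt
  have hN : Integrable (fun x => p x ^ 2 + q x ^ 2 + (p1 x ^ 2 + q1 x ^ 2)) := i0.add i1
  have hd : ∀ x, HasDerivAt (fun x => p x ^ 2 + q x ^ 2) (2 * (p x * p1 x + q x * q1 x)) x :=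
    fun x => (((hp x).fun_pow 2).fun_add ((hq x).fun_pow 2)).congr_deriv (by push_cast; ring)
  have hle : ∀ x, |2 * (p x * p1 x + q x * q1 x)| ≤ p x ^ 2 + q x ^ 2 + (p1 x ^ 2 + q1 x ^ 2) := by
    intro x
    rw [abs_le]
    constructor
    · nlinarith [sq_nonneg (p x + p1 x), sq_nonneg (q x + q1 x)]
    · nlinarith [sq_nonneg (p x - p1 x), sq_nonneg (q x - q1 x)]
  have hdi : Integrable (fun x => 2 * (p x * p1 x + q x * q1 x)) :=
    hN.mono' (by fun_prop : Continuous _).aestronglyMeasurable (Filter.Eventually.of_forall hle)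
  have h := integral_Iic_of_hasDerivAt_of_tendsto' (a := x) (fun y _ => hd y) hdi.integrableOn hz
  rw [sub_zero] at h
  rw [← h]
  calc ∫ y in Set.Iic x, 2 * (p y * p1 y + q y * q1 y)
      ≤ ∫ y in Set.Iic x, (p y ^ 2 + q y ^ 2 + (p1 y ^ 2 + q1 y ^ 2)) :=
        setIntegral_mono hdi.integrableOn hN.integrableOn fun y => (le_abs_self _).trans (hle y)
    _ ≤ ∫ y, (p y ^ 2 + q y ^ 2 + (p1 y ^ 2 + q1 y ^ 2)) :=
        setIntegral_le_integral hN (Filter.Eventually.of_forall fun y => by positivity)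
    _ ≤ B := by rw [integral_add i0 i1]; exact hB

/-- Estimate (4.8): time-integrability of the weighted H¹ norm for odd solutions of the
defocusing Hartree equation. -/
theorem time_integrability_defocusing_Hartree
    (a : ℝ) (ha0 : 0 < a) (ha1 : a < 1) :
    ∃ C > 0, ∀ ε : ℝ, 0 < ε → ∀ u : ℝ → ℝ → ℂ,
      ContDiff ℝ (⊤ : ℕ∞) (Function.uncurry u) →
      (∀ t x : ℝ, Complex.I * deriv (fun s => u s x) t + deriv (deriv (u t)) x
          = ((∫ y : ℝ, |x - y| ^ (-a) * ‖u t y‖ ^ 2 : ℝ) : ℂ) * u t x) →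
      (∀ t x : ℝ, u t (-x) = - u t x) →
      (∀ t : ℝ, ∃ g : SchwartzMap ℝ ℂ, ∀ x : ℝ, u t x = g x) →
      ((∫ x : ℝ, ‖u 0 x‖ ^ 2) + (∫ x : ℝ, ‖deriv (u 0) x‖ ^ 2) ≤ ε ^ 2) →
      (∀ t : ℝ, (∫ x : ℝ, ‖u t x‖ ^ 2) + (∫ x : ℝ, ‖deriv (u t) x‖ ^ 2) ≤ ε ^ 2) →
      ∫⁻ t in Set.Ici (0 : ℝ),
        ENNReal.ofReal (∫ x : ℝ, (1 / Real.cosh x) * (‖deriv (u t) x‖ ^ 2 + ‖u t x‖ ^ 2))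
      ≤ ENNReal.ofReal (C * ε ^ 2) := by
  refine ⟨1600, by norm_num, ?_⟩
  intro ε hε u hu hpde hodd hS _ hbd
  set P : ℝ × ℝ → ℝ := fun z => (Function.uncurry u z).re with hPdef
  set Q : ℝ × ℝ → ℝ := fun z => (Function.uncurry u z).im with hQdef
  have hP : ContDiff ℝ (⊤ : ℕ∞) P := Complex.reCLM.contDiff.comp hu
  have hQ : ContDiff ℝ (⊤ : ℕ∞) Q := Complex.imCLM.contDiff.comp hu
  have hPx := auxDx_smooth hP
  have hQx := auxDx_smooth hQ
  have k1 := hP.continuous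
  have k2 := hQ.continuous
  have k5 := hPx.continuous
  have k6 := hQx.continuous
  have hcomb : ∀ (f g : ℝ → ℝ) (f' g' x : ℝ), HasDerivAt f f' x → HasDerivAt g g' x →
      HasDerivAt (fun y => (⟨f y, g y⟩ : ℂ)) ⟨f', g'⟩ x := by
    intro f g f' g' x hf hg
    have h := hf.ofReal_comp.fun_add (hg.ofReal_comp.fun_mul (hasDerivAt_const x Complex.I))
    have e : (fun y => (⟨f y, g y⟩ : ℂ)) = fun y => ((f y : ℂ) + (g y : ℂ) * Complex.I) :=
      funext fun y => Complex.mk_eq_add_mul_I _ _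
    rw [e]
    exact h.congr_deriv (by rw [Complex.mk_eq_add_mul_I]; ring)
  have dx : ∀ t x, deriv (u t) x = ⟨auxDx P (t, x), auxDx Q (t, x)⟩ := fun t x =>
    (hcomb _ _ _ _ x (auxDx_has hP t x) (auxDx_has hQ t x)).deriv
  have dt : ∀ t x, deriv (fun s => u s x) t = ⟨auxDt P (t, x), auxDt Q (t, x)⟩ := fun t x =>
    (hcomb _ _ _ _ t (auxDt_has hP t x) (auxDt_has hQ t x)).deriv
  have dxx : ∀ t x, deriv (deriv (u t)) x
      = ⟨auxDx (auxDx P) (t, x), auxDx (auxDx Q) (t, x)⟩ := by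
    intro t x
    have e : deriv (u t) = fun y => ⟨auxDx P (t, y), auxDx Q (t, y)⟩ := funext (dx t)
    rw [e]
    exact (hcomb _ _ _ _ x (auxDx_has hPx t x) (auxDx_has hQx t x)).deriv
  have n0 : ∀ t x, ‖u t x‖ ^ 2 = P (t, x) ^ 2 + Q (t, x) ^ 2 := by
    intro t x
    rw [Complex.sq_norm, Complex.normSq_apply]
    simp only [hPdef, hQdef, Function.uncurry_apply_pair]; ring
  have n1 : ∀ t x, ‖deriv (u t) x‖ ^ 2 = auxDx P (t, x) ^ 2 + auxDx Q (t, x) ^ 2 := by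
    intro t x
    rw [dx, Complex.sq_norm, Complex.normSq_apply]
    ring
  have oP : ∀ t x, P (t, -x) = - P (t, x) := by
    intro t x; simp [hPdef, hodd]
  have oQ : ∀ t x, Q (t, -x) = - Q (t, x) := by
    intro t x; simp [hQdef, hodd]
  have i0 : ∀ t, Integrable (fun x => P (t, x) ^ 2 + Q (t, x) ^ 2) := by
    intro t
    obtain ⟨g, hg⟩ := hS t
    have e : (fun x => P (t, x) ^ 2 + Q (t, x) ^ 2) = fun x => ‖g x‖ ^ 2 := by
      funext x; rw [← n0, hg]
    rw [e]
    exact (g.memLp 2).integrable_norm_pow (by norm_num)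
  have i1 : ∀ t, Integrable (fun x => auxDx P (t, x) ^ 2 + auxDx Q (t, x) ^ 2) := by
    intro t
    obtain ⟨g, hg⟩ := hS t
    have hg' : u t = g := funext hg
    have e : (fun x => auxDx P (t, x) ^ 2 + auxDx Q (t, x) ^ 2)
        = fun x => ‖SchwartzMap.derivCLM ℝ ℂ g x‖ ^ 2 := by
      funext x; rw [← n1, hg', SchwartzMap.derivCLM_apply]
    rw [e]
    exact ((SchwartzMap.derivCLM ℝ ℂ g).memLp 2).integrable_norm_pow (by norm_num)
  have hb : ∀ t, (∫ x, P (t, x) ^ 2 + Q (t, x) ^ 2)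
      + (∫ x, auxDx P (t, x) ^ 2 + auxDx Q (t, x) ^ 2) ≤ ε ^ 2 := by
    intro t
    have := hbd t
    simpa only [n0, n1] using this
  have hs : ∀ t x, P (t, x) ^ 2 + Q (t, x) ^ 2 ≤ ε ^ 2 := by
    intro t
    refine aux_sup (fun x => P (t, x)) (fun x => Q (t, x)) (fun x => auxDx P (t, x))
      (fun x => auxDx Q (t, x)) (ε ^ 2) (auxDx_has hP t) (auxDx_has hQ t) (by fun_prop)
      (by fun_prop) (i0 t) (i1 t) ?_ (hb t)
    obtain ⟨g, hg⟩ := hS t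
    have e : (fun x => P (t, x) ^ 2 + Q (t, x) ^ 2) = fun x => ‖g x‖ ^ 2 := by
      funext x; rw [← n0, hg]
    rw [e]
    have h := (g.tendsto_cocompact.mono_left (atBot_le_cocompact (α := ℝ))).norm.pow 2
    simpa using h
  have e1 : ∀ t x, - auxDt Q (t, x) + auxDx (auxDx P) (t, x)
      = (∫ y, |x - y| ^ (-a) * (P (t, y) ^ 2 + Q (t, y) ^ 2)) * P (t, x) := by
    intro t x
    have h := congrArg Complex.re (hpde t x)
    rw [dt, dxx, Complex.re_ofReal_mul] at h
    simp only [n0] at h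
    simp at h
    exact h
  have e2 : ∀ t x, auxDt P (t, x) + auxDx (auxDx Q) (t, x)
      = (∫ y, |x - y| ^ (-a) * (P (t, y) ^ 2 + Q (t, y) ^ 2)) * Q (t, x) := by
    intro t x
    have h := congrArg Complex.im (hpde t x)
    rw [dt, dxx, Complex.im_ofReal_mul] at h
    simp only [n0] at h
    simp at h
    exact h
  have hcosh : Continuous (fun x : ℝ => 1 / cosh x) :=
    continuous_const.div continuous_cosh fun x => (cosh_pos x).ne'
  simp only [n0, n1]
  refine aux_lint (fun z => (1 / cosh z.2) *
      (auxDx P (z.1, z.2) ^ 2 + auxDx Q (z.1, z.2) ^ 2 + (P (z.1, z.2) ^ 2 + Q (z.1, z.2) ^ 2)))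
    ((hcosh.comp continuous_snd).mul (by fun_prop))
    (fun z => mul_nonneg (one_div_nonneg.2 (cosh_pos _).le) (by positivity)) ?_ _
    (fun n T hn hT => aux_core a ha0 ha1 ε P Q hP hQ oP oQ i0 i1 hs hb e1 e2 n T hn hT)
  intro t
  have hN : Integrable (fun x => auxDx P (t, x) ^ 2 + auxDx Q (t, x) ^ 2
      + (P (t, x) ^ 2 + Q (t, x) ^ 2)) := (i1 t).add (i0 t)
  refine hN.mono' (hcosh.mul (by fun_prop)).aestronglyMeasurable
    (Filter.Eventually.of_forall fun x => ?_)
  have hnn : 0 ≤ auxDx P (t, x) ^ 2 + auxDx Q (t, x) ^ 2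
      + (P (t, x) ^ 2 + Q (t, x) ^ 2) := by positivity
  have h1 : 1 / cosh x ≤ 1 := by
    rw [div_le_one (cosh_pos x)]; exact one_le_cosh x
  have h2 : 0 ≤ 1 / cosh x := one_div_nonneg.2 (cosh_pos x).le
  rw [Real.norm_eq_abs, abs_of_nonneg (mul_nonneg h2 hnn)]
  exact mul_le_of_le_one_left hnn h1
end
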